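/- Let X be the set of real numbers [0; a1, a2, …] whose continued fraction partial quotients all lie in {1,2} and whose digit sequence contains none of the following twenty-four strings, nor their reverses, as a consecutive substring: 21212, 21112121, 211121222, 111112121, 12111212, 111212111, 21112122112, 222111212211, 12211112121122, 112211121221111, 22111121211221, 21122111212211, 2111212211112, 22221111212112222, 12222111121211222112, 121222211112121122211, 2122221111212112221111, 21111221112122111221, 1211112211121221112222, 2212211121221111112, 21221221112122111111, 122122111212211111111, 111221221112122111111122, 22221221112122111111112. Then dim_H X < 0.5. -/

import Mathlib

open Filter

/-- Numerators of the convergents of the continued fraction `[a 0; a 1, a 2, …]`. -/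
def cfNum (a : ℕ → ℕ) : ℕ → ℕ
  | 0 => a 0
  | 1 => a 1 * a 0 + 1
  | n + 2 => a (n + 2) * cfNum a (n + 1) + cfNum a n

/-- Denominators of the convergents of the continued fraction `[a 0; a 1, a 2, …]`. -/
def cfDen (a : ℕ → ℕ) : ℕ → ℕ
  | 0 => 1
  | 1 => a 1
  | n + 2 => a (n + 2) * cfDen a (n + 1) + cfDen a n

/-- Value of the infinite continued fraction `[a 0; a 1, a 2, …]` (the limit of its
convergents). -/
noncomputable def cfVal (a : ℕ → ℕ) : ℝ :=
  limUnder atTop fun n => (cfNum a n : ℝ) / (cfDen a n)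

/-- Value of the infinite continued fraction `[0; a 0, a 1, …]`. -/
noncomputable def cf01 (a : ℕ → ℕ) : ℝ := 1 / cfVal a

/-- `λ₀(α) = [α 0; α 1, α 2, …] + [0; α (-1), α (-2), …]`. -/
noncomputable def lambda0 (α : ℤ → ℕ) : ℝ :=
  cfVal (fun n : ℕ => α (n : ℤ)) + cf01 (fun n : ℕ => α (-((n : ℤ) + 1)))

/-- The shift `σ^N` on bi-infinite sequences. -/
def shiftZ (N : ℤ) (α : ℤ → ℕ) : ℤ → ℕ := fun i => α (i + N)

/-- The Markov value `m(α) = sup_{n ∈ ℤ} λ₀(σⁿ α)`. -/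
noncomputable def markovValue (α : ℤ → ℕ) : ℝ := ⨆ n : ℤ, lambda0 (shiftZ n α)

/-- The Lagrange value `ℓ(α) = limsup_{n → +∞} λ₀(σⁿ α)`. -/
noncomputable def lagrangeValue (α : ℤ → ℕ) : ℝ :=
  limsup (fun n : ℕ => lambda0 (shiftZ (n : ℤ) α)) atTop

/-- The Markov spectrum `M`. -/
def MarkovSpectrum : Set ℝ :=
  { x | ∃ α : ℤ → ℕ, (∀ i, 1 ≤ α i) ∧ markovValue α = x }

/-- The Lagrange spectrum `L`. -/
def LagrangeSpectrum : Set ℝ :=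
  { x | ∃ α : ℤ → ℕ, (∀ i, 1 ≤ α i) ∧ lagrangeValue α = x }

/-- The finite word `w` occurs in the one-sided sequence `a` starting at position `i`. -/
def occursAtN (a : ℕ → ℕ) (i : ℕ) (w : List ℕ) : Prop :=
  ∀ j < w.length, a (i + j) = w.getD j 0

/-- The Gauss–Cantor set of reals `[0; a₁, a₂, …]` whose partial quotients all lie in `D`
and whose digit sequence contains no word of `F`, nor the reverse of a word of `F`, as a
consecutive substring. -/
noncomputable def gaussCantorRev (D : Set ℕ) (F : List (List ℕ)) : Set ℝ :=
  { x | ∃ a : ℕ → ℕ, (∀ n, a n ∈ D) ∧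
      (∀ w ∈ F, ∀ i, ¬ occursAtN a i w ∧ ¬ occursAtN a i w.reverse) ∧ x = cf01 a }

/-- The Gauss–Cantor set of reals `[0; a₁, a₂, …]` whose partial quotients all lie in `D`
and whose digit sequence contains no word of `F` as a consecutive substring. -/
noncomputable def gaussCantor (D : Set ℕ) (F : List (List ℕ)) : Set ℝ :=
  { x | ∃ a : ℕ → ℕ, (∀ n, a n ∈ D) ∧ (∀ w ∈ F, ∀ i, ¬ occursAtN a i w) ∧ x = cf01 a }

/-- The 24 forbidden words defining the Cantor set `X`. -/
def forbiddenX : List (List ℕ) :=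
  [[2, 1, 2, 1, 2],
   [2, 1, 1, 1, 2, 1, 2, 1],
   [2, 1, 1, 1, 2, 1, 2, 2, 2],
   [1, 1, 1, 1, 1, 2, 1, 2, 1],
   [1, 2, 1, 1, 1, 2, 1, 2],
   [1, 1, 1, 2, 1, 2, 1, 1, 1],
   [2, 1, 1, 1, 2, 1, 2, 2, 1, 1, 2],
   [2, 2, 2, 1, 1, 1, 2, 1, 2, 2, 1, 1],
   [1, 2, 2, 1, 1, 1, 1, 2, 1, 2, 1, 1, 2, 2],
   [1, 1, 2, 2, 1, 1, 1, 2, 1, 2, 2, 1, 1, 1, 1],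
   [2, 2, 1, 1, 1, 1, 2, 1, 2, 1, 1, 2, 2, 1],
   [2, 1, 1, 2, 2, 1, 1, 1, 2, 1, 2, 2, 1, 1],
   [2, 1, 1, 1, 2, 1, 2, 2, 1, 1, 1, 1, 2],
   [2, 2, 2, 2, 1, 1, 1, 1, 2, 1, 2, 1, 1, 2, 2, 2, 2],
   [1, 2, 2, 2, 2, 1, 1, 1, 1, 2, 1, 2, 1, 1, 2, 2, 2, 1, 1, 2],
   [1, 2, 1, 2, 2, 2, 2, 1, 1, 1, 1, 2, 1, 2, 1, 1, 2, 2, 2, 1, 1],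
   [2, 1, 2, 2, 2, 2, 1, 1, 1, 1, 2, 1, 2, 1, 1, 2, 2, 2, 1, 1, 1, 1],
   [2, 1, 1, 1, 1, 2, 2, 1, 1, 1, 2, 1, 2, 2, 1, 1, 1, 2, 2, 1],
   [1, 2, 1, 1, 1, 1, 2, 2, 1, 1, 1, 2, 1, 2, 2, 1, 1, 1, 2, 2, 2, 2],
   [2, 2, 1, 2, 2, 1, 1, 1, 2, 1, 2, 2, 1, 1, 1, 1, 1, 1, 2],
   [2, 1, 2, 2, 1, 2, 2, 1, 1, 1, 2, 1, 2, 2, 1, 1, 1, 1, 1, 1],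
   [1, 2, 2, 1, 2, 2, 1, 1, 1, 2, 1, 2, 2, 1, 1, 1, 1, 1, 1, 1, 1],
   [1, 1, 1, 2, 2, 1, 2, 2, 1, 1, 1, 2, 1, 2, 2, 1, 1, 1, 1, 1, 1, 1, 2, 2],
   [2, 2, 2, 2, 1, 2, 2, 1, 1, 1, 2, 1, 2, 2, 1, 1, 1, 1, 1, 1, 1, 1, 2]]

namespace GaussCantorBound

/-! ### Polynomials as coefficient lists -/

/-- Value at `z` of the polynomial with coefficient list `p` (constant term first). -/
def polyEval (p : List ℤ) (z : ℝ) : ℝ := p.foldr (fun c r => c + z * r) 0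

/-- Sum of two coefficient lists. -/
def polyAdd : List ℤ → List ℤ → List ℤ
  | [], q => q
  | p, [] => p
  | c :: p, e :: q => (c + e) :: polyAdd p q

/-- Multiple of a coefficient list by a constant. -/
def polyScale (k : ℤ) (p : List ℤ) : List ℤ := p.map (k * ·)

/-- Product of two coefficient lists. -/
def polyMul : List ℤ → List ℤ → List ℤ
  | [], _ => []
  | c :: p, q => polyAdd (polyScale c q) (0 :: polyMul p q)

/-- `polyScaledPow m k` is the polynomial `(m (1 + t)) ^ k`. -/
def polyScaledPow (m : ℤ) : ℕ → List ℤ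
  | 0 => [1]
  | k + 1 => polyMul [m, m] (polyScaledPow m k)

/-- The coefficients in `t` of `(m (1 + t)) ^ (p.length - 1) * p (z)` under the substitution
`z = n t / (m (1 + t))`, which maps `[0, ∞)` onto `[0, n / m)`. -/
def polyHomog (n m : ℤ) : List ℤ → List ℤ
  | [] => []
  | c :: p => polyAdd (polyScale c (polyScaledPow m p.length)) (0 :: polyScale n (polyHomog n m p))

/-- All coefficients are nonnegative. -/
def polyNonneg (p : List ℤ) : Bool := p.all (0 ≤ ·)

/-- The linear combination of the polynomials `rows` with coefficients `c`. -/
def polyComb : List ℤ → List (List ℤ) → List ℤ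
  | c :: cs, r :: rs => polyAdd (polyScale c r) (polyComb cs rs)
  | _, _ => []

@[simp] lemma polyEval_nil (z : ℝ) : polyEval [] z = 0 := rfl

@[simp] lemma polyEval_cons (c : ℤ) (p : List ℤ) (z : ℝ) :
    polyEval (c :: p) z = c + z * polyEval p z := rfl

@[simp] lemma polyEval_add (p q : List ℤ) (z : ℝ) :
    polyEval (polyAdd p q) z = polyEval p z + polyEval q z := by
  induction p, q using polyAdd.induct with
  | case1 q => simp [polyAdd]
  | case2 p h => cases p <;> simp [polyAdd]
  | case3 c p e q ih => simp [polyAdd, ih]; ring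

@[simp] lemma polyEval_scale (k : ℤ) (p : List ℤ) (z : ℝ) :
    polyEval (polyScale k p) z = k * polyEval p z := by
  induction p with
  | nil => simp [polyScale]
  | cons c p ih =>
    have : polyScale k (c :: p) = (k * c) :: polyScale k p := rfl
    rw [this, polyEval_cons, ih]; push_cast [polyEval_cons]; ring

@[simp] lemma polyEval_mul (p q : List ℤ) (z : ℝ) :
    polyEval (polyMul p q) z = polyEval p z * polyEval q z := by
  induction p with
  | nil => simp [polyMul]
  | cons c p ih => simp [polyMul, ih]; ring

lemma polyEval_scaledPow (m : ℤ) (k : ℕ) (t : ℝ) :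
    polyEval (polyScaledPow m k) t = (m * (1 + t)) ^ k := by
  induction k with
  | zero => simp [polyScaledPow]
  | succ k ih => simp [polyScaledPow, ih, pow_succ]; ring

lemma polyEval_homog {n m : ℤ} {z t : ℝ} (h : m * (1 + t) * z = n * t) (p : List ℤ) :
    polyEval (polyHomog n m p) t * (m * (1 + t)) = (m * (1 + t)) ^ p.length * polyEval p z := by
  induction p with
  | nil => simp [polyHomog]
  | cons c p ih =>
    simp only [polyHomog, polyEval_add, polyEval_scale, polyEval_scaledPow, polyEval_cons,
      List.length_cons, pow_succ]
    linear_combination (n * t) * ih + (m * (1 + t)) ^ p.length * polyEval p z * (-h)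

lemma polyEval_nonneg {p : List ℤ} (hp : polyNonneg p = true) {z : ℝ} (hz : 0 ≤ z) :
    0 ≤ polyEval p z := by
  induction p with
  | nil => simp
  | cons c p ih =>
    simp only [polyNonneg, List.all_cons, Bool.and_eq_true, decide_eq_true_eq] at hp
    have hc : (0 : ℝ) ≤ c := by exact_mod_cast hp.1
    have := ih hp.2
    rw [polyEval_cons]; positivity

/-- A polynomial whose transform by `polyHomog` has nonnegative coefficients is nonnegative on
`[0, n / m)`. -/
lemma polyEval_nonneg_of_homog {n m : ℤ} {p : List ℤ} (hp : polyNonneg (polyHomog n m p) = true)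
    (hm : 0 < m) {z : ℝ} (hz : 0 ≤ z) (hzn : m * z < n) : 0 ≤ polyEval p z := by
  have hm' : (0 : ℝ) < m := by exact_mod_cast hm
  have hd : 0 < (n : ℝ) - m * z := by linarith
  have ht : 0 ≤ m * z / (n - m * z) := by positivity
  have key := polyEval_homog (n := n) (m := m) (z := z) (t := m * z / (n - m * z))
    (by field_simp; ring) p
  have h1 := polyEval_nonneg hp ht
  by_contra hneg
  push Not at hneg
  have h2 : 0 < (m * (1 + m * z / (n - m * z)) : ℝ) ^ p.length := by positivity
  nlinarith [mul_neg_of_pos_of_neg h2 hneg,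
    mul_nonneg h1 (by positivity : (0 : ℝ) ≤ m * (1 + m * z / (n - m * z)))]

/-! ### The certificate -/

/-- If the last partial quotient read is `b`, the reversed prefix `[0; b, …]` lies in an interval
whose left and right end points are `leftEnd b / 1000` and `rightEnd b / 1000`. -/
def leftEnd : ℕ → ℤ
  | 1 => 570
  | _ => 360

/-- The numerator of the right end point of the interval described at `leftEnd`. -/
def rightEnd : ℕ → ℤ
  | 1 => 740
  | _ => 425

/-- Row `k` of `transferMatrix b a` holds `10 ^ 12` times the coefficients in
`z = rightEnd b / 1000 - x` of a polynomial upper bound on the interval of `b` for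
`(a + x)⁻¹ * (rightEnd a / 1000 - (a + x)⁻¹) ^ k`. -/
def transferMatrix : ℕ → ℕ → List (List ℤ)
  | 1, 1 =>
    [[574713084729, 330290842426, 190000573141, 106259842372, 80805963781],
     [94993947843, -135220163782, -187315795590, -162012711271, -184652984830],
     [15702397716, -53738059738, -3757514652, 41173007286, 126258234919],
     [2595602263, -14063363856, 13921594684, 20177081187, -10408586102],
     [429015171, -3181553206, 6448001575, 1211563947, -10220140810]]
  | 1, 2 =>
    [[364963528988, 133198133347, 48623089515, 17570535845, 7589864296],
     [21911174065, -40615365465, -32584293587, -18049150281, -11075168283],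
     [1315499453, -5357230629, 2402523805, 4614534862, 5384021952],
     [78984596, -496756640, 789612962, 263149635, -770991376],
     [4741963, -40350512, 110085880, -72348950, -74192358]]
  | 2, 1 =>
    [[701754395827, 492458984619, 345614028949, 241296563212, 191125990663],
     [26839060593, -326750181176, -471916593956, -496965572243, -545023020123],
     [1026524997, -25715074508, 133732645851, 313605954848, 568075835153],
     [39290253, -1488172374, 17323838413, -40974968370, -245856919698],
     [1512100, -76505407, 1413310674, -10934176977, 28160310563]]
  | _, _ =>
    [[412371134402, 170049943006, 70124816757, 28868820184, 12759699529],
     [5207780530, -67976134519, -56950725603, -35308531653, -21245627042],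
     [65769011, -1744060077, 10476876207, 13771245008, 13080220884],
     [830832, -33202936, 423481939, -1453265611, -3451410267],
     [10543, -561816, 11090909, -94692880, 289771751]]

/-- A state of the automaton recognising the admissible digit sequences. -/
structure CertState where
  /-- The most recent digits read, the last one first. -/
  label : List ℕ
  /-- The index of the state after reading the digit `1`. -/
  next₁ : ℕ
  /-- The index of the state after reading the digit `2`. -/
  next₂ : ℕ
  /-- The coefficients in `z = rightEnd b / 1000 - x`, where `b` is the last digit read, of a
  subsolution of the transfer operator. -/
  weight : List ℤ

set_option maxRecDepth 100000 in
/-- The states of the automaton. The out-of-range index `1000` marks a transition that completes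
a forbidden word. -/
def certStates : List CertState :=
  [⟨[1], 2, 3, [153608048458, 59330913403, 23632091914, 9535493267, 4866036475]⟩,
   ⟨[2], 4, 5, [167213993306, 72847176753, 32980529961, 15401268868, 8104084804]⟩,
   ⟨[1, 1], 6, 7, [152197579710, 58717841175, 23362151589, 9417329449, 4800538042]⟩,
   ⟨[2, 1], 8, 9, [160585868552, 69230688490, 31002223750, 14320456128, 7452001247]⟩,
   ⟨[1, 2], 10, 11, [138023030977, 54482910092, 22093532112, 9039763250, 4672682541]⟩,
   ⟨[2, 2], 12, 13, [166090303867, 72454059937, 32838608223, 15348197625, 8081749727]⟩,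
   ⟨[1, 1, 1], 14, 15, [150191358246, 58017591879, 23110546330, 9325466960, 4759159825]⟩,
   ⟨[2, 1, 1], 8, 16, [160083995625, 69070667265, 30951194976, 14304197757, 7446527444]⟩,
   ⟨[1, 2, 1], 17, 18, [128784287203, 51630113457, 21202406790, 8759631173, 4567892773]⟩,
   ⟨[2, 2, 1], 19, 20, [165928080034, 72376901132, 32801839533, 15330685205, 8072542523]⟩,
   ⟨[1, 1, 2], 21, 22, [147871771586, 56690663730, 22408291353, 8975398215, 4539362461]⟩,
   ⟨[2, 1, 2], 23, 24, [126405667896, 50876410793, 21133478265, 9023670349, 4317058071]⟩,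
   ⟨[1, 2, 2], 25, 26, [137717160104, 54345169665, 22031232939, 9011949052, 4656987929]⟩,
   ⟨[2, 2, 2], 27, 28, [163910052482, 71270175893, 32193641962, 14997066684, 7870574847]⟩,
   ⟨[1, 1, 1, 1], 29, 30, [148549237476, 57248804298, 22748948436, 9157940110, 4660117821]⟩,
   ⟨[2, 1, 1, 1], 31, 32, [157479259860, 67629899256, 30154197911, 13864690748, 7179145325]⟩,
   ⟨[2, 2, 1, 1], 33, 34, [164719433319, 71716774379, 32440802370, 15133599029, 7953768638]⟩,
   ⟨[1, 1, 2, 1], 35, 22, [146303976413, 55947641408, 22055970761, 8811330017, 4442003965]⟩,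
   ⟨[2, 1, 2, 1], 36, 37, [104438977863, 40065851553, 15812839271, 6411257845, 2907888207]⟩,
   ⟨[1, 2, 2, 1], 38, 39, [137492817313, 54244623952, 21985938516, 8991793037, 4645654596]⟩,
   ⟨[2, 2, 2, 1], 27, 40, [163905115502, 71268550306, 32193106704, 14996890627, 7870513574]⟩,
   ⟨[1, 1, 1, 2], 41, 42, [143269755847, 56004982912, 22524016898, 9155051148, 4701866741]⟩,
   ⟨[2, 1, 1, 2], 8, 43, [159688914531, 68944514112, 30910904408, 14291339724, 7442190523]⟩,
   ⟨[1, 2, 1, 2], 44, 1000, [80695489499, 35750062817, 15889976246, 6972717386, 3845166532]⟩,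
   ⟨[2, 2, 1, 2], 45, 46, [165923424167, 72374743325, 32800800232, 15330169691, 8072254984]⟩,
   ⟨[1, 1, 2, 2], 47, 48, [147380107772, 56520435686, 22347688621, 8953490536, 4529628040]⟩,
   ⟨[2, 1, 2, 2], 23, 49, [126389223297, 50871034468, 21131720539, 9023096282, 4316859762]⟩,
   ⟨[1, 2, 2, 2], 50, 51, [134686526240, 53396877302, 21729951188, 8915281306, 4619766889]⟩,
   ⟨[2, 2, 2, 2], 52, 28, [163843223454, 71238284094, 32178406513, 14989796799, 7866747094]⟩,
   ⟨[1, 1, 1, 1, 1], 53, 54, [145938537081, 56493393250, 22530174453, 9094893824, 4639220200]⟩,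
   ⟨[2, 1, 1, 1, 1], 31, 55, [157300930257, 67573255559, 30136204905, 13858980492, 7177230830]⟩,
   ⟨[1, 2, 1, 1, 1], 17, 56, [125115590162, 50535893667, 20876007806, 8662901949, 4534858260]⟩,
   ⟨[2, 2, 1, 1, 1], 57, 34, [164718220233, 71716116959, 32440446075, 15133406510, 7953654063]⟩,
   ⟨[1, 2, 2, 1, 1], 58, 59, [135792545262, 53714690269, 21818372074, 8938321933, 4625217187]⟩,
   ⟨[2, 2, 2, 1, 1], 60, 40, [163902522034, 71267347631, 32192548975, 14996632518, 7870381461]⟩,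
   ⟨[1, 1, 1, 2, 1], 61, 62, [140672771093, 55250634841, 22304841088, 9091744173, 4680869842]⟩,
   ⟨[1, 2, 1, 2, 1], 63, 1000, [49895022811, 22849878832, 10483910264, 4736361770, 2706770453]⟩,
   ⟨[2, 2, 1, 2, 1], 45, 64, [165922337072, 72374356161, 32800662344, 15330120643, 8072236442]⟩,
   ⟨[1, 1, 2, 2, 1], 65, 66, [147022374837, 56395446984, 22302710262, 8937035744, 4522191483]⟩,
   ⟨[2, 1, 2, 2, 1], 23, 67, [126372774067, 50865656628, 21129962319, 9022522053, 4316661397]⟩,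
   ⟨[2, 2, 2, 2, 1], 68, 28, [163831324717, 71232504835, 32175599441, 14988436565, 7866022453]⟩,
   ⟨[1, 1, 1, 1, 2], 69, 70, [148476335861, 57224450392, 22740742423, 9155172538, 4659001013]⟩,
   ⟨[2, 1, 1, 1, 2], 71, 32, [139253897875, 57669019979, 24709660664, 10897662374, 5396970199]⟩,
   ⟨[2, 2, 1, 1, 2], 72, 73, [163767937997, 71199650127, 32159061326, 14980275318, 7861619106]⟩,
   ⟨[1, 1, 2, 1, 2], 74, 22, [131745409271, 49092630047, 18826633063, 7316867357, 3562411915]⟩,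
   ⟨[1, 2, 2, 1, 2], 38, 75, [137489032163, 54243410645, 21985549541, 8991669283, 4645608672]⟩,
   ⟨[2, 2, 2, 1, 2], 27, 76, [163900366203, 71266986516, 32192591795, 14996721263, 7870454631]⟩,
   ⟨[1, 1, 1, 2, 2], 77, 42, [142878917084, 55819586453, 22436025562, 9114038273, 4677499986]⟩,
   ⟨[2, 1, 1, 2, 2], 78, 43, [159032139886, 68581181338, 30709897918, 14180485266, 7374745327]⟩,
   ⟨[2, 2, 1, 2, 2], 79, 46, [165883797459, 72354959835, 32790923164, 15325250976, 8069565558]⟩,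
   ⟨[1, 1, 2, 2, 2], 80, 48, [146652108878, 56175380638, 22184057532, 8877284637, 4484402742]⟩,
   ⟨[2, 1, 2, 2, 2], 81, 49, [119539862204, 47465709652, 19438641394, 8183429414, 3859591630]⟩,
   ⟨[1, 2, 2, 2, 2], 82, 83, [134592926997, 53354938549, 21711065561, 8906880861, 4615046480]⟩,
   ⟨[1, 1, 1, 1, 1, 1], 84, 85, [145927637069, 56489484769, 22528752345, 9094374364, 4638988892]⟩,
   ⟨[2, 1, 1, 1, 1, 1], 86, 55, [150402237840, 63766490203, 28035511451, 12703362267, 6476051033]⟩,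
   ⟨[2, 2, 1, 1, 1, 1], 87, 88, [164288792415, 71478552331, 32308946878, 15060822895, 7909442659]⟩,
   ⟨[2, 1, 2, 1, 1, 1], 89, 37, [94680160607, 35321355354, 13506128420, 5292406801, 2311304594]⟩,
   ⟨[1, 2, 2, 1, 1, 1], 58, 90, [135790837807, 53714142954, 21818196610, 8938266109, 4625196471]⟩,
   ⟨[1, 1, 2, 2, 1, 1], 91, 66, [146644537142, 56216359524, 22217783446, 8897483625, 4498718656]⟩,
   ⟨[2, 1, 2, 2, 1, 1], 92, 67, [122479407356, 48929557991, 20167153933, 8544923918, 4056515701]⟩,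
   ⟨[1, 2, 2, 2, 1, 1], 93, 51, [134682897626, 53395155314, 21729133589, 8914900088, 4619540302]⟩,
   ⟨[1, 1, 1, 1, 2, 1], 69, 94, [148474328806, 57223807042, 22740536171, 9155106918, 4658976662]⟩,
   ⟨[2, 1, 1, 1, 2, 1], 95, 32, [132372792102, 53941794484, 22690693089, 9807298669, 4748408668]⟩,
   ⟨[1, 1, 2, 1, 2, 1], 96, 22, [82030282491, 27333320062, 9284014234, 3187687570, 1329872257]⟩,
   ⟨[2, 2, 2, 1, 2, 1], 27, 97, [163897740960, 71266122109, 32192307172, 14996627645, 7870422049]⟩,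
   ⟨[1, 1, 1, 2, 2, 1], 98, 99, [142586308441, 55683253979, 22372112183, 9084491473, 4660061518]⟩,
   ⟨[2, 1, 1, 2, 2, 1], 100, 43, [158567165883, 68323957754, 30567596180, 14102007390, 7326999157]⟩,
   ⟨[2, 2, 1, 2, 2, 1], 101, 46, [165844159593, 72335170776, 32781043317, 15320330877, 8066875376]⟩,
   ⟨[1, 2, 2, 2, 2, 1], 102, 83, [134576251109, 53347743296, 21707959874, 8905559444, 4614349103]⟩,
   ⟨[1, 1, 1, 1, 1, 2], 103, 54, [145922182068, 56485870550, 22526711485, 9093325874, 4638322865]⟩,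
   ⟨[2, 1, 1, 1, 1, 2], 31, 104, [157132340660, 67519552202, 30119096383, 13853535026, 7175399477]⟩,
   ⟨[1, 2, 1, 1, 1, 2], 17, 105, [99453794955, 42544209985, 18385125995, 7891578478, 4257326128]⟩,
   ⟨[1, 2, 2, 1, 1, 2], 106, 107, [134462183448, 53296331589, 21684656765, 8895125291, 4608433556]⟩,
   ⟨[2, 2, 2, 1, 1, 2], 108, 40, [163886754584, 71260035756, 32189158161, 14995063298, 7869578257]⟩,
   ⟨[1, 1, 1, 2, 1, 2], 61, 109, [116592371247, 48053295488, 20153307340, 8452759766, 4462089928]⟩,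
   ⟨[2, 1, 2, 2, 1, 2], 23, 110, [126362606332, 50862332433, 21128875512, 9022167106, 4316538781]⟩,
   ⟨[2, 2, 2, 2, 1, 2], 111, 28, [163819878316, 71226945276, 32172899082, 14987128042, 7865325359]⟩,
   ⟨[1, 1, 1, 1, 2, 2], 112, 113, [147828795838, 57037126883, 22686513324, 9139555313, 4653832547]⟩,
   ⟨[1, 2, 1, 1, 2, 2], 17, 114, [127859057656, 51354208219, 21120121565, 8735250277, 4559568133]⟩,
   ⟨[1, 2, 2, 1, 2, 2], 115, 75, [137433438467, 54220903556, 21976435293, 8988021894, 4643831041]⟩,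
   ⟨[1, 1, 1, 2, 2, 2], 77, 116, [141672990713, 55469456984, 22334357874, 9084697553, 4667783988]⟩,
   ⟨[1, 2, 1, 2, 2, 2], 117, 1000, [71087803286, 31821214483, 14282933765, 6323377684, 3524685553]⟩,
   ⟨[1, 1, 2, 2, 2, 2], 118, 119, [146502532671, 56122953911, 22165121457, 8870329147, 4481241654]⟩,
   ⟨[2, 1, 2, 2, 2, 2], 81, 120, [119533579601, 47463655645, 19437969860, 8183210094, 3859515866]⟩,
   ⟨[1, 1, 1, 1, 1, 1, 1], 121, 85, [145920283413, 56486084206, 22527179087, 9093658819, 4638577169]⟩,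
   ⟨[2, 1, 1, 1, 1, 1, 1], 86, 122, [150385240399, 63761093374, 28033797901, 12702818726, 6475868906]⟩,
   ⟨[1, 2, 1, 1, 1, 1, 1], 17, 123, [115398118439, 47611167945, 19995625808, 8399655412, 4444014406]⟩,
   ⟨[1, 2, 2, 1, 1, 1, 1], 58, 124, [135187885252, 53535236822, 21765106012, 8922612731, 4619882286]⟩,
   ⟨[2, 2, 2, 1, 1, 1, 1], 125, 40, [163899035435, 71265730783, 32191799177, 14996285522, 7870203852]⟩,
   ⟨[1, 2, 1, 2, 1, 1, 1], 126, 1000, [36217705552, 16961110394, 7947602940, 3659433677, 2139935817]⟩,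
   ⟨[2, 1, 2, 2, 1, 1, 1], 92, 127, [122474820761, 48928058470, 20166663683, 8544763803, 4056460391]⟩,
   ⟨[1, 1, 1, 2, 2, 1, 1], 98, 128, [141960421545, 55501537737, 22319348142, 9069264415, 4655019304]⟩,
   ⟨[1, 2, 1, 2, 2, 1, 1], 129, 1000, [75234169545, 33517930777, 14977424981, 6604176121, 3663391330]⟩,
   ⟨[1, 1, 2, 2, 2, 1, 1], 80, 130, [146646096435, 56173644566, 22183556195, 8877140737, 4484355390]⟩,
   ⟨[2, 1, 1, 1, 1, 2, 1], 31, 131, [157126949275, 67517789565, 30118520109, 13853346817, 7175334461]⟩,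
   ⟨[1, 2, 1, 1, 1, 2, 1], 17, 1000, [89768641556, 39434335983, 17386403681, 7573290825, 4138973071]⟩,
   ⟨[1, 1, 1, 2, 1, 2, 1], 132, 1000, [35633936832, 16683968333, 7815965103, 3598033300, 2103424159]⟩,
   ⟨[2, 2, 2, 2, 1, 2, 1], 133, 28, [163813551156, 71223872152, 32171406420, 14986404737, 7864940031]⟩,
   ⟨[1, 1, 1, 1, 2, 2, 1], 112, 134, [147371200272, 56904916487, 22648310542, 9128583266, 4650219512]⟩,
   ⟨[2, 1, 1, 1, 2, 2, 1], 71, 135, [139209729023, 57654996053, 24705207935, 10896249967, 5396496938]⟩,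
   ⟨[1, 2, 1, 1, 2, 2, 1], 17, 136, [127204027148, 51158866783, 21061860462, 8717986787, 4553673320]⟩,
   ⟨[1, 2, 2, 1, 2, 2, 1], 137, 75, [137377829117, 54198390122, 21967318474, 8984373474, 4642052908]⟩,
   ⟨[1, 1, 2, 2, 2, 2, 1], 138, 119, [146475457388, 56111997893, 22160687007, 8868555384, 4480377710]⟩,
   ⟨[1, 1, 1, 1, 1, 1, 2], 139, 140, [145900724321, 56480647860, 22525836064, 9093414314, 4638614486]⟩,
   ⟨[2, 2, 1, 1, 1, 1, 2], 141, 88, [163882791829, 71256091940, 32186930239, 14994045329, 7869102291]⟩,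
   ⟨[2, 1, 2, 1, 1, 1, 2], 1000, 142, [26022791824, 8403836462, 2714534992, 876118122, 298997550]⟩,
   ⟨[1, 1, 2, 2, 1, 1, 2], 143, 66, [146294375943, 56050391936, 22139079173, 8860829845, 4476966185]⟩,
   ⟨[2, 1, 2, 2, 1, 1, 2], 144, 67, [119523412974, 47460331812, 19436883173, 8182855185, 3859393265]⟩,
   ⟨[1, 2, 2, 2, 1, 1, 2], 145, 51, [134660836822, 53384686177, 21724162849, 8912582404, 4618162727]⟩,
   ⟨[2, 1, 1, 1, 2, 1, 2], 1000, 32, [68300695223, 23078263933, 7812924774, 2647030292, 952502862]⟩,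
   ⟨[2, 2, 1, 2, 2, 1, 2], 146, 46, [165819658305, 72322938599, 32774936305, 15317289626, 8065212498]⟩,
   ⟨[1, 2, 2, 2, 2, 1, 2], 147, 83, [134560209164, 53340821573, 21704972252, 8904288261, 4613678237]⟩,
   ⟨[1, 1, 1, 1, 1, 2, 2], 148, 54, [145919434478, 56484745876, 22526250998, 9093139633, 4638230833]⟩,
   ⟨[2, 1, 1, 1, 1, 2, 2], 149, 104, [155421368795, 66575084004, 29597722784, 13566619029, 7001244226]⟩,
   ⟨[2, 1, 2, 1, 1, 2, 2], 150, 37, [101977907141, 38868355934, 15230154413, 6128400748, 2756951448]⟩,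
   ⟨[1, 1, 2, 2, 1, 2, 2], 151, 66, [146933220426, 56353189540, 22282670923, 8927703012, 4516652819]⟩,
   ⟨[2, 1, 1, 1, 2, 2, 2], 152, 32, [136057181881, 55936379952, 23770524092, 10390151240, 5094891675]⟩,
   ⟨[1, 1, 2, 1, 2, 2, 2], 153, 22, [116308734876, 41938151539, 15509165095, 5804753107, 2689882675]⟩,
   ⟨[1, 1, 1, 2, 2, 2, 2], 154, 155, [141549422829, 55412232119, 22307644758, 9072383976, 4660533907]⟩,
   ⟨[2, 1, 1, 2, 2, 2, 2], 156, 43, [158839638472, 68474689420, 30650984166, 14147994921, 7354978076]⟩,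
   ⟨[2, 2, 1, 2, 2, 2, 2], 157, 46, [165868658210, 72347401620, 32787149665, 15323371798, 8068538072]⟩,
   ⟨[1, 1, 1, 1, 1, 1, 1, 1], 121, 158, [145908168760, 56482185109, 22525923978, 9093257903, 4638427688]⟩,
   ⟨[2, 2, 1, 1, 1, 1, 1, 1], 159, 88, [164247861994, 71455878929, 32296386448, 15053886625, 7905216447]⟩,
   ⟨[2, 1, 2, 1, 1, 1, 1, 1], 1000, 37, [68800690275, 23237644605, 7863734629, 2663213791, 957949457]⟩,
   ⟨[2, 1, 2, 2, 1, 1, 1, 1], 160, 127, [120872034545, 48131351012, 19770629782, 8348392767, 3949540321]⟩,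
   ⟨[1, 2, 2, 2, 1, 1, 1, 1], 161, 51, [134678019401, 53392840312, 21728034427, 8914387587, 4619235684]⟩,
   ⟨[1, 1, 2, 1, 2, 1, 1, 1], 1000, 22, [59833136805, 18297069699, 5604430473, 1707292369, 603299676]⟩,
   ⟨[2, 2, 1, 2, 2, 1, 1, 1], 162, 46, [165833107230, 72329652925, 32778288486, 15318958990, 8066125263]⟩,
   ⟨[2, 1, 1, 1, 2, 2, 1, 1], 163, 135, [137550608801, 56755664722, 24217704463, 10632779547, 5239660785]⟩,
   ⟨[1, 1, 2, 1, 2, 2, 1, 1], 164, 22, [122971559441, 45021408873, 16936623762, 6454423181, 3064029710]⟩,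
   ⟨[2, 1, 1, 2, 2, 2, 1, 1], 165, 43, [159016212943, 68572370539, 30705023583, 14177797118, 7373109847]⟩,
   ⟨[2, 2, 1, 1, 1, 1, 2, 1], 166, 88, [163869800156, 71249605907, 32183692041, 14992432731, 7868220566]⟩,
   ⟨[1, 1, 1, 1, 2, 1, 2, 1], 1000, 94, [58865773079, 18018240864, 5524069642, 1684275987, 595747191]⟩,
   ⟨[1, 2, 2, 2, 2, 1, 2, 1], 167, 83, [134551341751, 53336995493, 21703320801, 8903585596, 4613307407]⟩,
   ⟨[2, 1, 1, 1, 1, 2, 2, 1], 168, 104, [154209105699, 65905970343, 29228388069, 13363390498, 6877899132]⟩,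
   ⟨[2, 2, 1, 1, 1, 2, 2, 1], 169, 34, [164611860132, 71657198069, 32407806257, 15115381544, 7942671454]⟩,
   ⟨[2, 1, 2, 1, 1, 2, 2, 1], 170, 37, [100235542491, 38020754359, 14817815412, 5928280399, 2650186319]⟩,
   ⟨[1, 1, 2, 2, 1, 2, 2, 1], 171, 66, [146844040907, 56310920221, 22262625965, 8918367669, 4511112609]⟩,
   ⟨[1, 1, 1, 2, 2, 2, 2, 1], 172, 155, [141506006779, 55391631488, 22297864928, 9067824578, 4657824377]⟩,
   ⟨[1, 1, 1, 1, 1, 1, 1, 2], 173, 85, [145917067835, 56484597222, 22526491139, 9093345928, 4638397132]⟩,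
   ⟨[2, 1, 1, 1, 1, 1, 1, 2], 86, 174, [150318283339, 63739833948, 28027047806, 12700677585, 6475151462]⟩,
   ⟨[1, 2, 2, 1, 1, 1, 1, 2], 175, 176, [134616163626, 53358814714, 21710005626, 8905283985, 4613391132]⟩,
   ⟨[2, 2, 1, 2, 1, 1, 1, 2], 177, 1000, [62688899982, 32749573783, 17155460494, 8985059808, 5193901006]⟩,
   ⟨[1, 1, 1, 2, 2, 1, 1, 2], 98, 178, [141380382070, 55333124511, 22270444495, 9055150753, 4650345520]⟩,
   ⟨[1, 2, 1, 2, 2, 1, 1, 2], 179, 1000, [71087803286, 31821214483, 14282933765, 6323377684, 3524685553]⟩,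
   ⟨[1, 1, 2, 2, 2, 1, 1, 2], 80, 180, [146609542713, 56163089808, 22180508227, 8876265875, 4484067506]⟩,
   ⟨[1, 2, 2, 1, 2, 2, 1, 2], 181, 75, [137343455402, 54184473930, 21961683108, 8982118282, 4640953793]⟩,
   ⟨[1, 1, 2, 2, 2, 2, 1, 2], 182, 119, [146449411386, 56101458373, 22156421134, 8866849052, 4479546610]⟩,
   ⟨[1, 1, 1, 1, 1, 1, 2, 2], 183, 140, [145896308943, 56478606050, 22524891428, 9092984677, 4638367274]⟩,
   ⟨[1, 2, 1, 1, 1, 1, 2, 2], 17, 184, [122705485266, 49811452756, 20658225121, 8597865409, 4512448348]⟩,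
   ⟨[1, 2, 1, 2, 1, 1, 2, 2], 185, 1000, [46445642428, 21367456505, 9846594864, 4466231103, 2564912527]⟩,
   ⟨[1, 1, 1, 2, 2, 1, 2, 2], 98, 186, [142438624415, 55640376505, 22359662127, 9080898557, 4658871784]⟩,
   ⟨[1, 2, 1, 1, 1, 2, 2, 2], 17, 187, [94954299362, 41102514121, 17923120667, 7744649584, 4202827248]⟩,
   ⟨[1, 1, 1, 2, 1, 2, 2, 2], 61, 1000, [91148934761, 39936308195, 17563338669, 7632542005, 4159339001]⟩,
   ⟨[1, 1, 1, 1, 2, 2, 2, 2], 112, 188, [147639332054, 56982386369, 22670695851, 9135012460, 4652336615]⟩,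
   ⟨[2, 1, 1, 1, 2, 2, 2, 2], 152, 189, [136032401465, 55928511993, 23768025940, 10389358825, 5094626157]⟩,
   ⟨[1, 2, 1, 1, 2, 2, 2, 2], 17, 190, [127587871943, 51273336365, 21096001445, 8728103222, 4557127705]⟩,
   ⟨[1, 2, 2, 1, 2, 2, 2, 2], 191, 75, [137412199084, 54212304796, 21972953224, 8986628420, 4643151903]⟩,
   ⟨[2, 1, 1, 1, 1, 1, 1, 1, 1], 86, 192, [150352679018, 63750754864, 28030515314, 12701777484, 6475520011]⟩,
   ⟨[1, 2, 2, 1, 1, 1, 1, 1, 1], 58, 193, [135130221343, 53518126274, 21760028230, 8921115523, 4619373973]⟩,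
   ⟨[1, 2, 1, 2, 2, 1, 1, 1, 1], 194, 1000, [72985937629, 32598135230, 14601018345, 6452017239, 3588249383]⟩,
   ⟨[1, 1, 2, 2, 2, 1, 1, 1, 1], 80, 195, [146638013444, 56171310631, 22182882209, 8876947282, 4484291731]⟩,
   ⟨[1, 2, 2, 1, 2, 2, 1, 1, 1], 196, 75, [137362323370, 54192112624, 21964776399, 8983356173, 4641557105]⟩,
   ⟨[1, 2, 1, 1, 1, 2, 2, 1, 1], 17, 197, [97118513686, 41796173018, 18145479911, 7815386971, 4229074666]⟩,
   ⟨[1, 1, 1, 2, 1, 2, 2, 1, 1], 61, 198, [102127173236, 43460002081, 18694512600, 7992902057, 4293275493]⟩,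
   ⟨[1, 2, 1, 1, 2, 2, 2, 1, 1], 17, 199, [127836620629, 51347517151, 21118125949, 8734658954, 4559366221]⟩,
   ⟨[1, 2, 2, 1, 1, 1, 1, 2, 1], 200, 176, [134597937154, 53351435696, 21707017477, 8904088166, 4612808321]⟩,
   ⟨[1, 1, 2, 2, 2, 2, 1, 2, 1], 201, 119, [146435014088, 56095632504, 22154063112, 8865905853, 4479087207]⟩,
   ⟨[1, 2, 1, 1, 1, 1, 2, 2, 1], 17, 202, [120997877173, 49297993175, 20503814290, 8551737830, 4496547628]⟩,
   ⟨[1, 2, 2, 1, 1, 1, 2, 2, 1], 58, 203, [135640994679, 53669682193, 21805002890, 8934376054, 4623875838]⟩,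
   ⟨[1, 2, 1, 2, 1, 1, 2, 2, 1], 204, 1000, [44003604319, 20317432450, 9394949023, 4274706092, 2464271762]⟩,
   ⟨[1, 1, 1, 2, 2, 1, 2, 2, 1], 98, 205, [142290898819, 55597486846, 22347208501, 9077304601, 4657681702]⟩,
   ⟨[1, 1, 1, 1, 2, 2, 2, 2, 1], 112, 206, [147567395907, 56961602264, 22664690186, 9133287599, 4651768627]⟩,
   ⟨[1, 1, 1, 1, 1, 1, 1, 1, 2], 121, 207, [145902871313, 56480480127, 22525375149, 9093082592, 4638362324]⟩,
   ⟨[2, 2, 1, 1, 1, 1, 1, 1, 2], 208, 88, [164086627097, 71366562910, 32246907890, 15026563002, 7888568396]⟩,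
   ⟨[1, 1, 2, 2, 1, 1, 1, 1, 2], 209, 66, [146544049099, 56168730666, 22195197114, 8886964814, 4492476176]⟩,
   ⟨[2, 1, 2, 2, 1, 1, 1, 1, 2], 210, 127, [119518826379, 47458832291, 19436392922, 8182695071, 3859337954]⟩,
   ⟨[1, 2, 2, 1, 2, 1, 1, 1, 2], 211, 75, [88104902975, 31624981568, 11606775967, 4302389974, 1965474950]⟩,
   ⟨[2, 1, 1, 1, 2, 2, 1, 1, 2], 212, 135, [136013013029, 55922356026, 23766071362, 10388738832, 5094418414]⟩,
   ⟨[1, 1, 2, 1, 2, 2, 1, 1, 2], 213, 22, [116308734876, 41938151539, 15509165095, 5804753107, 2689882675]⟩,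
   ⟨[2, 1, 1, 2, 2, 2, 1, 1, 2], 214, 43, [158919382245, 68518803721, 30675389195, 14161454047, 7363166658]⟩,
   ⟨[1, 1, 2, 2, 1, 2, 2, 1, 2], 215, 66, [146788916519, 56284792363, 22250235615, 8912597233, 4507688052]⟩,
   ⟨[1, 1, 1, 2, 2, 2, 2, 1, 2], 216, 155, [141464241210, 55371814002, 22288456884, 9063438509, 4655217853]⟩,
   ⟨[1, 1, 1, 1, 1, 1, 1, 2, 2], 173, 217, [145909793798, 56482256075, 22525737530, 9093105205, 4638307379]⟩,
   ⟨[2, 1, 2, 1, 1, 1, 1, 2, 2], 218, 37, [88262694095, 32307088109, 12090306894, 4628807908, 1968071735]⟩,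
   ⟨[1, 1, 2, 1, 2, 1, 1, 2, 2], 219, 22, [76434277036, 25043664949, 8346931598, 2808845567, 1142762794]⟩,
   ⟨[2, 1, 1, 1, 2, 2, 1, 2, 2], 220, 135, [138818243921, 57442786248, 24590172464, 10834078056, 5359487080]⟩,
   ⟨[2, 1, 2, 1, 1, 1, 2, 2, 2], 1000, 221, [13936868000, 4441074886, 1415198992, 450529753, 151531579]⟩,
   ⟨[2, 1, 1, 1, 1, 2, 2, 2, 2], 222, 104, [154919441122, 66298040275, 29444799813, 13482471491, 6950172197]⟩,
   ⟨[2, 2, 1, 1, 1, 2, 2, 2, 2], 223, 34, [164658548145, 71683061205, 32422133886, 15123293812, 7947492397]⟩,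
   ⟨[2, 1, 2, 1, 1, 2, 2, 2, 2], 224, 37, [101256560464, 38517437233, 15059436557, 6045544456, 2712746315]⟩,
   ⟨[1, 1, 2, 2, 1, 2, 2, 2, 2], 225, 66, [146899159285, 56337045235, 22275014970, 8924137479, 4514536796]⟩,
   ⟨[2, 2, 1, 1, 1, 1, 1, 1, 1, 1], 226, 88, [164169453072, 71412444323, 32272324895, 15040599073, 7897120453]⟩,
   ⟨[2, 1, 2, 2, 1, 1, 1, 1, 1, 1], 227, 127, [120718749834, 48055169909, 19732767580, 8329622235, 3939321840]⟩,
   ⟨[1, 1, 2, 1, 2, 2, 1, 1, 1, 1], 228, 22, [119359003794, 43348876544, 16161917450, 6101673485, 2860758169]⟩,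
   ⟨[2, 1, 1, 2, 2, 2, 1, 1, 1, 1], 229, 43, [158994801126, 68560525504, 30698470638, 14174183234, 7370911145]⟩,
   ⟨[1, 1, 2, 2, 1, 2, 2, 1, 1, 1], 230, 66, [146819174675, 56299134124, 22257036763, 8915764665, 4509567815]⟩,
   ⟨[2, 1, 2, 1, 1, 1, 2, 2, 1, 1], 1000, 231, [19750339236, 6343004618, 2037437431, 653889273, 221831649]⟩,
   ⟨[2, 1, 1, 1, 2, 1, 2, 2, 1, 1], 1000, 232, [29495503534, 9552193657, 3094210195, 1001492290, 342803218]⟩,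
   ⟨[2, 1, 2, 1, 1, 2, 2, 2, 1, 1], 233, 37, [101918225263, 38839321926, 15216029640, 6121545392, 2753293992]⟩,
   ⟨[1, 1, 2, 2, 1, 1, 1, 1, 2, 1], 234, 66, [146514819673, 56154876643, 22188627327, 8883905161, 4490660400]⟩,
   ⟨[1, 1, 1, 2, 2, 2, 2, 1, 2, 1], 235, 155, [141441154698, 55360859606, 22283256455, 9061014048, 4653777059]⟩,
   ⟨[2, 1, 2, 1, 1, 1, 1, 2, 2, 1], 236, 37, [83715580955, 30174691936, 11090287234, 4160831677, 1726339873]⟩,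
   ⟨[2, 1, 2, 2, 1, 1, 1, 2, 2, 1], 237, 127, [122076503591, 48730060441, 20068239254, 8495959685, 4029887029]⟩,
   ⟨[1, 1, 2, 1, 2, 1, 1, 2, 2, 1], 238, 22, [72472109869, 23424738486, 7685269501, 2541703713, 1011049529]⟩,
   ⟨[2, 1, 1, 1, 2, 2, 1, 2, 2, 1], 239, 135, [138426648488, 57230518787, 24475106904, 10771890510, 5322468314]⟩,
   ⟨[2, 1, 1, 1, 1, 2, 2, 2, 2, 1], 240, 104, [154728867717, 66192852824, 29386739043, 13450523322, 6930782024]⟩,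
   ⟨[2, 1, 1, 1, 1, 1, 1, 1, 1, 2], 86, 241, [150338440706, 63746234081, 28029079917, 12701322174, 6475367448]⟩,
   ⟨[1, 2, 2, 1, 1, 1, 1, 1, 1, 2], 58, 242, [134903069168, 53450723567, 21740025554, 8915217634, 4617371594]⟩,
   ⟨[1, 1, 1, 2, 2, 1, 1, 1, 1, 2], 98, 243, [141793963789, 55453207337, 22305314088, 9065214188, 4653678067]⟩,
   ⟨[1, 2, 1, 2, 2, 1, 1, 1, 1, 2], 244, 1000, [71087803286, 31821214483, 14282933765, 6323377684, 3524685553]⟩,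
   ⟨[1, 1, 2, 2, 1, 2, 1, 1, 1, 2], 245, 1000, [65830108676, 29352145690, 13121899196, 5786639700, 3208880993]⟩,
   ⟨[1, 2, 1, 1, 1, 2, 2, 1, 1, 2], 17, 246, [94954299362, 41102514121, 17923120667, 7744649584, 4202827248]⟩,
   ⟨[1, 1, 1, 2, 1, 2, 2, 1, 1, 2], 61, 1000, [91148934761, 39936308195, 17563338669, 7632542005, 4159339001]⟩,
   ⟨[1, 2, 1, 1, 2, 2, 2, 1, 1, 2], 17, 247, [127700210711, 51306837586, 21105993230, 8731063899, 4558138657]⟩,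
   ⟨[1, 1, 1, 2, 2, 1, 2, 2, 1, 2], 98, 248, [142199585444, 55570975501, 22339510543, 9075083067, 4656946075]⟩,
   ⟨[1, 1, 1, 1, 2, 2, 2, 2, 1, 2], 112, 249, [147498194449, 56941608264, 22658912822, 9131628306, 4651222230]⟩,
   ⟨[2, 1, 1, 1, 1, 1, 1, 1, 2, 2], 86, 250, [150365689471, 63754885792, 28031826927, 12702193530, 6475659418]⟩,
   ⟨[1, 2, 1, 2, 1, 1, 1, 1, 2, 2], 251, 1000, [27234712383, 12803098646, 6022061109, 2782854408, 1634946148]⟩,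
   ⟨[1, 1, 1, 2, 1, 2, 1, 1, 2, 2], 252, 1000, [26641871351, 12521756855, 5888478237, 2720568503, 1597924289]⟩,
   ⟨[1, 2, 1, 1, 1, 2, 2, 1, 2, 2], 17, 253, [98902762821, 42367714813, 18328586473, 7873603812, 4250661701]⟩,
   ⟨[2, 2, 1, 2, 1, 1, 1, 2, 2, 2], 254, 1000, [33563298404, 18368865443, 10054355773, 5486958568, 3300977412]⟩,
   ⟨[1, 2, 1, 1, 1, 1, 2, 2, 2, 2], 17, 255, [121998463738, 49598866343, 20594297020, 8578768647, 4505865733]⟩,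
   ⟨[1, 2, 2, 1, 1, 1, 2, 2, 2, 2], 58, 256, [135706770077, 53689198771, 21810794431, 8936083641, 4624455546]⟩,
   ⟨[1, 2, 1, 2, 1, 1, 2, 2, 2, 2], 257, 1000, [45434626997, 20932763278, 9659630050, 4386950593, 2523255542]⟩,
   ⟨[1, 1, 1, 2, 2, 1, 2, 2, 2, 2], 98, 258, [142382202239, 55623995273, 22354905604, 9079525886, 4658417246]⟩,
   ⟨[1, 2, 2, 1, 1, 1, 1, 1, 1, 1, 1], 58, 259, [135019756688, 53485348198, 21750300894, 8918247371, 4618400214]⟩,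
   ⟨[1, 2, 1, 2, 2, 1, 1, 1, 1, 1, 1], 260, 1000, [72770926219, 32510133618, 14564990703, 6437447630, 3581050626]⟩,
   ⟨[1, 1, 1, 2, 1, 2, 2, 1, 1, 1, 1], 61, 261, [96174191135, 41552861032, 18083437557, 7798592477, 4221213988]⟩,
   ⟨[1, 2, 1, 1, 2, 2, 2, 1, 1, 1, 1], 17, 262, [127806456804, 51338521832, 21115443088, 8733863994, 4559094775]⟩,
   ⟨[1, 1, 1, 2, 2, 1, 2, 2, 1, 1, 1], 98, 263, [142249707983, 55585527762, 22343736006, 9076302482, 4657349866]⟩,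
   ⟨[2, 2, 1, 2, 1, 1, 1, 2, 2, 1, 1], 264, 1000, [47572306772, 25344637408, 13528024721, 7212367134, 4242024498]⟩,
   ⟨[2, 2, 1, 1, 1, 2, 1, 2, 2, 1, 1], 265, 1000, [71059438959, 36746614632, 19058707848, 9886272113, 5660769191]⟩,
   ⟨[1, 2, 1, 2, 1, 1, 2, 2, 2, 1, 1], 266, 1000, [46361994285, 21331491770, 9831126324, 4459671894, 2561466114]⟩,
   ⟨[1, 1, 1, 2, 2, 1, 1, 1, 1, 2, 1], 98, 267, [141745545448, 55439149227, 22301231925, 9064036074, 4653287932]⟩,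
   ⟨[1, 1, 1, 1, 2, 2, 2, 2, 1, 2, 1], 112, 268, [147459942361, 56930556295, 22655719301, 9130711108, 4650920201]⟩,
   ⟨[1, 2, 1, 2, 1, 1, 1, 1, 2, 2, 1], 269, 1000, [20870148388, 9847850699, 4649208511, 2155996065, 1272400348]⟩,
   ⟨[1, 2, 1, 2, 2, 1, 1, 1, 2, 2, 1], 270, 1000, [74675448715, 33289357947, 14883890857, 6566367533, 3644721089]⟩,
   ⟨[1, 1, 1, 2, 1, 2, 1, 1, 2, 2, 1], 271, 1000, [20276830267, 9566287361, 4515522711, 2093663157, 1235351302]⟩,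
   ⟨[1, 2, 1, 1, 1, 2, 2, 1, 2, 2, 1], 17, 272, [98351575624, 42191163977, 18272027197, 7855622264, 4243994460]⟩,
   ⟨[1, 2, 1, 1, 1, 1, 2, 2, 2, 2, 1], 17, 273, [121730019829, 49518147184, 20570022361, 8571516928, 4503365947]⟩,
   ⟨[2, 2, 1, 1, 1, 1, 1, 1, 1, 1, 2], 274, 88, [164135166729, 71393451418, 32261803362, 15034788751, 7893580273]⟩,
   ⟨[2, 1, 2, 2, 1, 1, 1, 1, 1, 1, 2], 275, 127, [120114923931, 47755075700, 19583620867, 8255681821, 3899069677]⟩,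
   ⟨[2, 1, 1, 1, 2, 2, 1, 1, 1, 1, 2], 276, 135, [137109355091, 56516520039, 24088091272, 10562741457, 5197976292]⟩,
   ⟨[1, 1, 2, 1, 2, 2, 1, 1, 1, 1, 2], 277, 22, [116308734876, 41938151539, 15509165095, 5804753107, 2689882675]⟩,
   ⟨[1, 1, 1, 2, 2, 1, 2, 1, 1, 1, 2], 278, 99, [107617119929, 39314719598, 14705901541, 5556277427, 2598131439]⟩,
   ⟨[2, 1, 2, 1, 1, 1, 2, 2, 1, 1, 2], 1000, 279, [13936868000, 4441074886, 1415198992, 450529753, 151531579]⟩,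
   ⟨[2, 1, 2, 1, 1, 2, 2, 2, 1, 1, 2], 280, 37, [101555378590, 38662804872, 15130155946, 6079867309, 2731058031]⟩,
   ⟨[2, 1, 1, 1, 2, 2, 1, 2, 2, 1, 2], 281, 135, [138184592226, 57099310834, 24403982258, 10733451143, 5299586384]⟩,
   ⟨[2, 1, 1, 1, 1, 2, 2, 2, 2, 1, 2], 282, 104, [154545539042, 66091664336, 29330885717, 13419789873, 6912129138]⟩,
   ⟨[2, 2, 1, 1, 1, 1, 1, 1, 1, 2, 2], 283, 88, [164200782690, 71429799358, 32281939097, 15045908340, 7900355345]⟩,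
   ⟨[1, 1, 2, 1, 2, 1, 1, 1, 1, 2, 2], 1000, 284, [45031143869, 13550913285, 4082376474, 1222894598, 423473475]⟩,
   ⟨[1, 1, 1, 1, 2, 1, 2, 1, 1, 2, 2], 1000, 285, [44048830679, 13267292680, 4000479507, 1199389511, 415739642]⟩,
   ⟨[2, 1, 2, 1, 1, 1, 2, 2, 1, 2, 2], 1000, 286, [24542759637, 7917347556, 2554624046, 823610377, 280756315]⟩,
   ⟨[1, 2, 2, 1, 2, 1, 1, 1, 2, 2, 2], 1000, 75, [47260743540, 14647628787, 4545190837, 1401799210, 502248410]⟩,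
   ⟨[2, 1, 2, 1, 1, 1, 1, 2, 2, 2, 2], 287, 37, [86380006798, 31424050126, 11676126931, 4434954714, 1867924131]⟩,
   ⟨[2, 1, 2, 2, 1, 1, 1, 2, 2, 2, 2], 288, 127, [122251349589, 48816973896, 20111443709, 8517382749, 4041551662]⟩,
   ⟨[1, 1, 2, 1, 2, 1, 1, 2, 2, 2, 2], 289, 22, [74793937382, 24373335527, 8072927103, 2698203267, 1088201549]⟩,
   ⟨[2, 1, 1, 1, 2, 2, 1, 2, 2, 2, 2], 290, 135, [138668678332, 57361712928, 24546224339, 10810326128, 5345348106]⟩,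
   ⟨[2, 1, 2, 2, 1, 1, 1, 1, 1, 1, 1, 1], 291, 127, [120425107856, 47909232927, 19660236728, 8293664502, 3919746877]⟩,
   ⟨[1, 1, 2, 1, 2, 2, 1, 1, 1, 1, 1, 1], 292, 22, [119013487302, 43189060559, 16087961423, 6068029264, 2841393535]⟩,
   ⟨[2, 1, 1, 1, 2, 1, 2, 2, 1, 1, 1, 1], 1000, 293, [13505745917, 4304192849, 1371738384, 436744263, 146912500]⟩,
   ⟨[2, 1, 2, 1, 1, 2, 2, 2, 1, 1, 1, 1], 294, 37, [101837990312, 38800289285, 15197040634, 6112329218, 2748376999]⟩,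
   ⟨[2, 1, 1, 1, 2, 2, 1, 2, 2, 1, 1, 1], 295, 135, [138317458574, 57171331758, 24443023039, 10754550755, 5312146416]⟩,
   ⟨[1, 2, 2, 1, 2, 1, 1, 1, 2, 2, 1, 1], 296, 75, [66912522629, 22653815478, 7807824344, 2715404116, 1147575360]⟩,
   ⟨[1, 2, 2, 1, 1, 1, 2, 1, 2, 2, 1, 1], 297, 90, [99828698736, 36874313788, 13928177953, 5305681994, 2501219385]⟩,
   ⟨[1, 1, 2, 1, 2, 1, 1, 2, 2, 2, 1, 1], 298, 22, [76298560928, 24988202577, 8324260090, 2799690617, 1138248033]⟩,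
   ⟨[2, 1, 1, 1, 2, 2, 1, 1, 1, 1, 2, 1], 299, 135, [136981005547, 56446959299, 24050390506, 10542369498, 5185851610]⟩,
   ⟨[2, 1, 1, 1, 1, 2, 2, 2, 2, 1, 2, 1], 300, 104, [154444201512, 66035731013, 29300012056, 13402801570, 6901818530]⟩,
   ⟨[1, 1, 2, 1, 2, 1, 1, 1, 1, 2, 2, 1], 1000, 301, [34536521347, 10227300056, 3029649307, 891922246, 302354579]⟩,
   ⟨[1, 1, 2, 1, 2, 2, 1, 1, 1, 2, 2, 1], 302, 22, [122073790797, 44605717446, 16744057423, 6366732234, 3013491127]⟩,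
   ⟨[1, 1, 1, 1, 2, 1, 2, 1, 1, 2, 2, 1], 1000, 303, [33553421464, 9943430401, 2947673484, 868392376, 294611682]⟩,
   ⟨[2, 1, 2, 1, 1, 1, 2, 2, 1, 2, 2, 1], 1000, 304, [23062303846, 7430835624, 2394743723, 771125192, 262527482]⟩,
   ⟨[2, 1, 2, 1, 1, 1, 1, 2, 2, 2, 2, 1], 305, 37, [85665178443, 31088844642, 11518935467, 4361398131, 1829930339]⟩,
   ⟨[1, 2, 2, 1, 1, 1, 1, 1, 1, 1, 1, 2], 58, 306, [134971453141, 53471015112, 21746047353, 8916993193, 4617974410]⟩,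
   ⟨[1, 2, 1, 2, 2, 1, 1, 1, 1, 1, 1, 2], 307, 1000, [71923943970, 32163469023, 14423065093, 6380052023, 3552691302]⟩,
   ⟨[1, 2, 1, 1, 1, 2, 2, 1, 1, 1, 1, 2], 17, 308, [96497434722, 41597122353, 18081676490, 7795091022, 4221544345]⟩,
   ⟨[1, 1, 1, 2, 1, 2, 2, 1, 1, 1, 1, 2], 61, 1000, [91148934761, 39936308195, 17563338669, 7632542005, 4159339001]⟩,
   ⟨[1, 1, 1, 1, 2, 2, 1, 2, 1, 1, 1, 2], 112, 1000, [89606862060, 39204838411, 17216153699, 7470698355, 4063159863]⟩,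
   ⟨[2, 2, 1, 2, 1, 1, 1, 2, 2, 1, 1, 2], 309, 1000, [33563298404, 18368865443, 10054355773, 5486958568, 3300977412]⟩,
   ⟨[1, 2, 1, 2, 1, 1, 2, 2, 2, 1, 1, 2], 310, 1000, [45853440450, 21112836625, 9737081612, 4419793404, 2540512584]⟩,
   ⟨[1, 2, 1, 1, 1, 2, 2, 1, 2, 2, 1, 2], 17, 311, [98010871223, 42082031252, 18237065246, 7844506856, 4239872991]⟩,
   ⟨[1, 2, 1, 1, 1, 1, 2, 2, 2, 2, 1, 2], 17, 312, [121471780953, 49440496003, 20546670153, 8564540725, 4500961115]⟩,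
   ⟨[1, 2, 2, 1, 1, 1, 1, 1, 1, 1, 2, 2], 58, 313, [135063894719, 53498445237, 21754187618, 8919393391, 4618789296]⟩,
   ⟨[2, 1, 1, 2, 1, 2, 1, 1, 1, 1, 2, 2], 8, 314, [119925794002, 55973112873, 26678134789, 12911157956, 6966047855]⟩,
   ⟨[2, 1, 1, 1, 1, 2, 1, 2, 1, 1, 2, 2], 31, 315, [117323671461, 54533255765, 25881455767, 12471762029, 6698706992]⟩,
   ⟨[2, 2, 1, 2, 1, 1, 1, 2, 2, 1, 2, 2], 316, 1000, [59121987381, 31005386512, 16302549325, 8568982564, 4970851972]⟩,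
   ⟨[1, 2, 1, 2, 1, 1, 1, 1, 2, 2, 2, 2], 317, 1000, [24599512514, 11579885453, 5453999796, 2523550342, 1485035804]⟩,
   ⟨[1, 2, 1, 2, 2, 1, 1, 1, 2, 2, 2, 2], 318, 1000, [74920705772, 33389692958, 14924948993, 6582964197, 3652916709]⟩,
   ⟨[1, 1, 1, 2, 1, 2, 1, 1, 2, 2, 2, 2], 319, 1000, [24006671481, 11298543662, 5320416925, 2461264436, 1448013945]⟩,
   ⟨[1, 2, 1, 1, 1, 2, 2, 1, 2, 2, 2, 2], 17, 320, [98692242896, 42300283393, 18306984431, 7866736029, 4248115259]⟩,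
   ⟨[1, 2, 1, 2, 2, 1, 1, 1, 1, 1, 1, 1, 1], 321, 1000, [72359036681, 32341551027, 14495972955, 6409536619, 3567259849]⟩,
   ⟨[1, 1, 1, 2, 1, 2, 2, 1, 1, 1, 1, 1, 1], 61, 322, [95604946141, 41369820753, 18024572399, 7779806614, 4214217301]⟩,
   ⟨[2, 2, 1, 1, 1, 2, 1, 2, 2, 1, 1, 1, 1], 323, 1000, [32525142141, 17793739643, 9735730627, 5310991925, 3193754746]⟩,
   ⟨[1, 2, 1, 2, 1, 1, 2, 2, 2, 1, 1, 1, 1], 324, 1000, [46249539637, 21283141561, 9810330736, 4450853819, 2556832819]⟩,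
   ⟨[1, 2, 1, 1, 1, 2, 2, 1, 2, 2, 1, 1, 1], 17, 325, [98197886211, 42141935023, 18256256145, 7850608201, 4242135304]⟩,
   ⟨[1, 1, 2, 2, 1, 2, 1, 1, 1, 2, 2, 1, 1], 326, 1000, [31552303617, 14747589262, 6896865242, 3169623175, 1848895951]⟩,
   ⟨[1, 1, 2, 2, 1, 1, 1, 2, 1, 2, 2, 1, 1], 91, 1000, [87234862096, 38041562696, 16648662467, 7200326166, 3898753995]⟩,
   ⟨[1, 1, 1, 2, 1, 2, 1, 1, 2, 2, 2, 1, 1], 327, 1000, [26423842712, 12420558458, 5841484700, 2699118623, 1585524581]⟩,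
   ⟨[1, 2, 1, 1, 1, 2, 2, 1, 1, 1, 1, 2, 1], 17, 328, [96316778604, 41539222452, 18063116981, 7789187107, 4219353791]⟩,
   ⟨[1, 2, 1, 1, 1, 1, 2, 2, 2, 2, 1, 2, 1], 17, 329, [121329035751, 49397573064, 20533761800, 8560684490, 4499631791]⟩,
   ⟨[2, 1, 1, 2, 1, 2, 1, 1, 1, 1, 2, 2, 1], 8, 1000, [91782796713, 45992242364, 23138218760, 11657151041, 6494019042]⟩,
   ⟨[1, 1, 1, 2, 1, 2, 2, 1, 1, 1, 2, 2, 1], 61, 330, [100647742277, 42986240559, 18542776742, 7944673132, 4275398090]⟩,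
   ⟨[2, 1, 1, 1, 1, 2, 1, 2, 1, 1, 2, 2, 1], 31, 1000, [89178564637, 44551635322, 22341273137, 11217660456, 6226642463]⟩,
   ⟨[2, 2, 1, 2, 1, 1, 1, 2, 2, 1, 2, 2, 1], 331, 1000, [55554074555, 29259083407, 15447807266, 8151625924, 4746922088]⟩,
   ⟨[1, 2, 1, 2, 1, 1, 1, 1, 2, 2, 2, 2, 1], 332, 1000, [23598973901, 11115258703, 5238136241, 2424975046, 1428017032]⟩,
   ⟨[2, 1, 2, 2, 1, 1, 1, 1, 1, 1, 1, 1, 2], 333, 127, [120296705235, 47845418511, 19628521058, 8277941295, 3911187394]⟩,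
   ⟨[1, 1, 2, 1, 2, 2, 1, 1, 1, 1, 1, 1, 2], 334, 22, [117652410191, 42559524937, 15796648475, 5935508667, 2765121583]⟩,
   ⟨[2, 1, 2, 1, 1, 1, 2, 2, 1, 1, 1, 1, 2], 1000, 335, [18082024483, 5796943769, 1858703315, 595448146, 201618999]⟩,
   ⟨[1, 2, 2, 1, 2, 1, 1, 1, 2, 2, 1, 1, 2], 1000, 75, [47260743540, 14647628787, 4545190837, 1401799210, 502248410]⟩,
   ⟨[1, 1, 2, 1, 2, 1, 1, 2, 2, 2, 1, 1, 2], 336, 22, [75473449757, 24651013577, 8186428347, 2744033726, 1110801335]⟩,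
   ⟨[2, 1, 2, 1, 1, 1, 2, 2, 1, 2, 2, 1, 2], 1000, 337, [22147190267, 7130140316, 2295938075, 738692933, 251264570]⟩,
   ⟨[2, 1, 2, 1, 1, 1, 1, 2, 2, 2, 2, 1, 2], 338, 37, [84977523954, 30766393222, 11367730241, 4290645246, 1793385801]⟩,
   ⟨[2, 1, 2, 2, 1, 1, 1, 1, 1, 1, 1, 2, 2], 339, 127, [120542437502, 47967544493, 19689217627, 8308031999, 3927568367]⟩,
   ⟨[2, 2, 1, 1, 2, 1, 2, 1, 1, 1, 1, 2, 2], 1000, 73, [67955430835, 22968318741, 7777900308, 2635878876, 948749554]⟩,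
   ⟨[2, 2, 1, 1, 1, 1, 2, 1, 2, 1, 1, 2, 2], 1000, 88, [67960524939, 22970015327, 7778465359, 2636066862, 948815768]⟩,
   ⟨[1, 2, 2, 1, 2, 1, 1, 1, 2, 2, 1, 2, 2], 340, 75, [83104677266, 29499792442, 10703231919, 3923490647, 1769229680]⟩,
   ⟨[1, 1, 2, 1, 2, 1, 1, 1, 1, 2, 2, 2, 2], 1000, 341, [40686225382, 12173165523, 3645439080, 1085354313, 373068001]⟩,
   ⟨[1, 1, 2, 1, 2, 2, 1, 1, 1, 2, 2, 2, 2], 342, 22, [122467877080, 44788188972, 16828585611, 6405224476, 3035675029]⟩,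
   ⟨[1, 1, 1, 1, 2, 1, 2, 1, 1, 2, 2, 2, 2], 1000, 343, [39703912193, 11889544918, 3563542112, 1061849225, 365334168]⟩,
   ⟨[2, 1, 2, 1, 1, 1, 2, 2, 1, 2, 2, 2, 2], 1000, 344, [23977316017, 7731525049, 2493556455, 803562729, 273793305]⟩,
   ⟨[1, 1, 2, 1, 2, 2, 1, 1, 1, 1, 1, 1, 1, 1], 345, 22, [118351593103, 42882911095, 15946290624, 6003581032, 2804299705]⟩,
   ⟨[2, 1, 1, 1, 2, 1, 2, 2, 1, 1, 1, 1, 1, 1], 1000, 346, [11975950429, 3815149425, 1215400325, 386815372, 130063839]⟩,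
   ⟨[1, 2, 2, 1, 1, 1, 2, 1, 2, 2, 1, 1, 1, 1], 1000, 90, [45798156058, 14213746512, 4416464258, 1363853748, 489369850]⟩,
   ⟨[1, 1, 2, 1, 2, 1, 1, 2, 2, 2, 1, 1, 1, 1], 347, 22, [76116107269, 24913640402, 8293781176, 2787382998, 1132178552]⟩,
   ⟨[2, 1, 2, 1, 1, 1, 2, 2, 1, 2, 2, 1, 1, 1], 1000, 348, [22649502483, 7295192745, 2350172316, 756494799, 257446661]⟩,
   ⟨[1, 1, 1, 2, 2, 1, 2, 1, 1, 1, 2, 2, 1, 1], 1000, 99, [52103169793, 16062821833, 4958714569, 1521846423, 542256478]⟩,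
   ⟨[1, 1, 1, 1, 2, 1, 2, 1, 1, 2, 2, 2, 1, 1], 1000, 349, [43689350176, 13153273781, 3964310232, 1188001126, 411564791]⟩,
   ⟨[2, 1, 2, 1, 1, 1, 2, 2, 1, 1, 1, 1, 2, 1], 1000, 350, [17596752715, 5638129630, 1806728055, 578455969, 195742861]⟩,
   ⟨[2, 1, 2, 1, 1, 1, 1, 2, 2, 2, 2, 1, 2, 1], 351, 37, [84597413007, 30588156326, 11284151979, 4251537395, 1773186486]⟩,
   ⟨[2, 1, 1, 1, 2, 1, 2, 2, 1, 1, 1, 2, 2, 1], 1000, 352, [25521977296, 8244169481, 2663625117, 859899726, 293538032]⟩,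
   ⟨[1, 2, 2, 1, 2, 1, 1, 1, 2, 2, 1, 2, 2, 1], 353, 75, [78102875175, 27378414841, 9803212843, 3546835738, 1574659087]⟩,
   ⟨[1, 1, 2, 1, 2, 1, 1, 1, 1, 2, 2, 2, 2, 1], 1000, 354, [39036384937, 11650882555, 3480078928, 1033387175, 354059877]⟩,
   ⟨[1, 2, 1, 2, 2, 1, 1, 1, 1, 1, 1, 1, 1, 2], 355, 1000, [72178927264, 32267832962, 14465792379, 6397331342, 3561229148]⟩,
   ⟨[1, 1, 1, 2, 1, 2, 2, 1, 1, 1, 1, 1, 1, 2], 61, 356, [93362561388, 40648693891, 17792631447, 7705777340, 4186641540]⟩,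
   ⟨[2, 2, 1, 2, 1, 1, 1, 2, 2, 1, 1, 1, 1, 2], 357, 1000, [43552040798, 23346340261, 12534735889, 6719871082, 3973881009]⟩,
   ⟨[1, 1, 1, 2, 1, 2, 1, 1, 2, 2, 2, 1, 1, 2], 358, 1000, [25098300819, 11805286055, 5555761274, 2568698106, 1510128306]⟩,
   ⟨[2, 2, 1, 2, 1, 1, 1, 2, 2, 1, 2, 2, 1, 2], 359, 1000, [53348647663, 28179194809, 14919026917, 7893324223, 4608278012]⟩,
   ⟨[1, 2, 1, 2, 1, 1, 1, 1, 2, 2, 2, 2, 1, 2], 360, 1000, [22636471513, 10668263869, 5030449868, 2330127541, 1373149724]⟩,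
   ⟨[1, 2, 1, 2, 2, 1, 1, 1, 1, 1, 1, 1, 2, 2], 361, 1000, [72523614147, 32408911168, 14523550252, 6420688987, 3572770223]⟩,
   ⟨[1, 1, 2, 2, 1, 2, 1, 1, 1, 2, 2, 1, 2, 2], 362, 1000, [57736057697, 25939509107, 11682595924, 5187714725, 2901762131]⟩,
   ⟨[2, 1, 1, 2, 1, 2, 1, 1, 1, 1, 2, 2, 2, 2], 8, 363, [108272162969, 51873459598, 25235893365, 12404401667, 6776953659]⟩,
   ⟨[1, 1, 1, 2, 1, 2, 2, 1, 1, 1, 2, 2, 2, 2], 61, 364, [101297155254, 43194208902, 18609386347, 7965845392, 4283246416]⟩,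
   ⟨[2, 1, 1, 1, 1, 2, 1, 2, 1, 1, 2, 2, 2, 2], 31, 365, [105670040428, 50433602490, 24439214344, 11965005740, 6509612795]⟩,
   ⟨[2, 2, 1, 2, 1, 1, 1, 2, 2, 1, 2, 2, 2, 2], 366, 1000, [57759261935, 30338470661, 15976154122, 8409624672, 4885357442]⟩,
   ⟨[1, 1, 1, 2, 1, 2, 2, 1, 1, 1, 1, 1, 1, 1, 1], 61, 367, [94514466438, 41019157358, 17911793595, 7743813012, 4200810781]⟩,
   ⟨[2, 2, 1, 1, 1, 2, 1, 2, 2, 1, 1, 1, 1, 1, 1], 368, 1000, [28840752362, 15799154175, 8655899625, 4728139354, 2847271739]⟩,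
   ⟨[1, 1, 1, 2, 1, 2, 1, 1, 2, 2, 2, 1, 1, 1, 1], 369, 1000, [26130730089, 12284508941, 5778306986, 2670281434, 1568854316]⟩,
   ⟨[2, 2, 1, 2, 1, 1, 1, 2, 2, 1, 2, 2, 1, 1, 1], 370, 1000, [54559221607, 28771971531, 15209296161, 8035121019, 4684390013]⟩,
   ⟨[2, 1, 1, 1, 1, 2, 1, 2, 1, 1, 2, 2, 2, 1, 1], 31, 371, [116359463213, 54194629594, 25762530403, 12430046281, 6683168901]⟩,
   ⟨[2, 2, 1, 2, 1, 1, 1, 2, 2, 1, 1, 1, 1, 2, 1], 372, 1000, [42382648044, 22764785159, 12245513745, 6576394053, 3895724783]⟩,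
   ⟨[1, 2, 1, 2, 1, 1, 1, 1, 2, 2, 2, 2, 1, 2, 1], 373, 1000, [22104434718, 10421173530, 4915641196, 2277694447, 1342817098]⟩,
   ⟨[2, 2, 1, 1, 1, 2, 1, 2, 2, 1, 1, 1, 2, 2, 1], 374, 1000, [61482805167, 32090605288, 16794976213, 8788247595, 5075280524]⟩,
   ⟨[1, 1, 2, 2, 1, 2, 1, 1, 1, 2, 2, 1, 2, 2, 1], 375, 1000, [49642831001, 22508227086, 10227360646, 4578915148, 2587412529]⟩,
   ⟨[2, 1, 1, 2, 1, 2, 1, 1, 1, 1, 2, 2, 2, 2, 1], 8, 376, [103848109599, 50300303586, 24676486615, 12205727579, 6701971096]⟩,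
   ⟨[1, 1, 2, 1, 2, 2, 1, 1, 1, 1, 1, 1, 1, 1, 2], 377, 22, [118062161945, 42749042853, 15884344844, 5975401731, 2788081415]⟩,
   ⟨[2, 1, 1, 1, 2, 1, 2, 2, 1, 1, 1, 1, 1, 1, 2], 1000, 378, [5949633369, 1890405928, 600652394, 190663592, 63933986]⟩,
   ⟨[1, 2, 2, 1, 2, 1, 1, 1, 2, 2, 1, 1, 1, 1, 2], 379, 75, [61273295169, 20346468886, 6863498357, 2333632700, 959018366]⟩,
   ⟨[1, 1, 1, 1, 2, 1, 2, 1, 1, 2, 2, 2, 1, 1, 2], 1000, 380, [41503812422, 12460159950, 3744467431, 1118789321, 386196268]⟩,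
   ⟨[1, 2, 2, 1, 2, 1, 1, 1, 2, 2, 1, 2, 2, 1, 2], 381, 75, [75011072983, 26068350490, 9247928879, 3314662749, 1454865472]⟩,
   ⟨[1, 1, 2, 1, 2, 1, 1, 1, 1, 2, 2, 2, 2, 1, 2], 1000, 382, [37449239997, 11148586811, 3321091262, 983436395, 335795164]⟩,
   ⟨[1, 1, 2, 1, 2, 2, 1, 1, 1, 1, 1, 1, 1, 2, 2], 383, 22, [118616064256, 43005237933, 16002897228, 6029332165, 2819120965]⟩,
   ⟨[1, 1, 1, 2, 2, 1, 2, 1, 1, 1, 2, 2, 1, 2, 2], 384, 99, [94535660712, 33683062967, 12280576995, 4526572922, 2056220570]⟩,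
   ⟨[2, 2, 1, 1, 2, 1, 2, 1, 1, 1, 1, 2, 2, 2, 2], 1000, 385, [39821958274, 12990843494, 4239194577, 1382302846, 476883781]⟩,
   ⟨[2, 1, 1, 1, 2, 1, 2, 2, 1, 1, 1, 2, 2, 2, 2], 1000, 386, [27266208003, 8818239819, 2852567675, 922019939, 315147808]⟩,
   ⟨[2, 2, 1, 1, 1, 1, 2, 1, 2, 1, 1, 2, 2, 2, 2], 1000, 387, [39827052378, 12992540080, 4239759628, 1382490831, 476949994]⟩,
   ⟨[1, 2, 2, 1, 2, 1, 1, 1, 2, 2, 1, 2, 2, 2, 2], 388, 75, [81194300457, 28689377620, 10359327214, 3779536798, 1694846031]⟩,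
   ⟨[2, 1, 1, 1, 2, 1, 2, 2, 1, 1, 1, 1, 1, 1, 1, 1], 1000, 389, [9045358479, 2878698857, 916161733, 291289566, 97842586]⟩,
   ⟨[1, 2, 2, 1, 1, 1, 2, 1, 2, 2, 1, 1, 1, 1, 1, 1], 1000, 390, [40612498253, 12545568374, 3879747271, 1192494988, 425515673]⟩,
   ⟨[1, 1, 1, 1, 2, 1, 2, 1, 1, 2, 2, 2, 1, 1, 1, 1], 1000, 391, [43206072374, 12999992602, 3915687174, 1172691831, 405952721]⟩,
   ⟨[1, 2, 2, 1, 2, 1, 1, 1, 2, 2, 1, 2, 2, 1, 1, 1], 392, 75, [76708186385, 26787403759, 9552685247, 3442077514, 1520601497]⟩,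
   ⟨[2, 2, 1, 1, 1, 1, 2, 1, 2, 1, 1, 2, 2, 2, 1, 1], 1000, 393, [65632895784, 22136443901, 7479943314, 2529294348, 908214331]⟩,
   ⟨[1, 2, 2, 1, 2, 1, 1, 1, 2, 2, 1, 1, 1, 1, 2, 1], 394, 75, [59632955515, 19676139464, 6589493863, 2222990400, 904457120]⟩,
   ⟨[1, 1, 2, 1, 2, 1, 1, 1, 1, 2, 2, 2, 2, 1, 2, 1], 1000, 395, [36571917240, 10870968060, 3233229644, 955835360, 325704167]⟩,
   ⟨[1, 2, 2, 1, 1, 1, 2, 1, 2, 2, 1, 1, 1, 2, 2, 1], 396, 90, [86406708618, 31095713877, 11439423036, 4248986799, 1945062749]⟩,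
   ⟨[1, 1, 1, 2, 2, 1, 2, 1, 1, 1, 2, 2, 1, 2, 2, 1], 397, 99, [81441249500, 28126184753, 9921624790, 3538801598, 1545588240]⟩,
   ⟨[2, 2, 1, 1, 2, 1, 2, 1, 1, 1, 1, 2, 2, 2, 2, 1], 1000, 398, [29138682165, 9438683285, 3058099454, 990015374, 338949580]⟩,
   ⟨[1, 1, 1, 2, 1, 2, 2, 1, 1, 1, 1, 1, 1, 1, 1, 2], 61, 399, [94037627709, 40865803832, 17862467103, 7728068593, 4194945691]⟩,
   ⟨[2, 2, 1, 1, 1, 2, 1, 2, 2, 1, 1, 1, 1, 1, 1, 2], 400, 1000, [14327160549, 7917707646, 4375795558, 2410772178, 1465122756]⟩,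
   ⟨[1, 1, 2, 2, 1, 2, 1, 1, 1, 2, 2, 1, 1, 1, 1, 2], 401, 1000, [22490780838, 10553255940, 4954516114, 2285398236, 1339505910]⟩,
   ⟨[2, 1, 1, 1, 1, 2, 1, 2, 1, 1, 2, 2, 2, 1, 1, 2], 31, 402, [110497459592, 52134215193, 25038315528, 12175802093, 6588386287]⟩,
   ⟨[1, 1, 2, 2, 1, 2, 1, 1, 1, 2, 2, 1, 2, 2, 1, 2], 403, 1000, [44641035687, 20382371034, 9323533128, 4199896981, 2391105729]⟩,
   ⟨[2, 1, 1, 2, 1, 2, 1, 1, 1, 1, 2, 2, 2, 2, 1, 2], 8, 404, [99592340024, 48784289182, 24136437771, 12013587338, 6629317434]⟩,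
   ⟨[1, 1, 1, 2, 1, 2, 2, 1, 1, 1, 1, 1, 1, 1, 2, 2], 61, 405, [94950185936, 41159272687, 17956857468, 7758195435, 4206167878]⟩,
   ⟨[1, 1, 1, 1, 2, 2, 1, 2, 1, 1, 1, 2, 2, 1, 2, 2], 406, 1000, [68377172517, 30560013560, 13694976592, 6053656302, 3367438861]⟩,
   ⟨[2, 2, 2, 1, 1, 2, 1, 2, 1, 1, 1, 1, 2, 2, 2, 2], 108, 1000, [95954325707, 48299247549, 24413721856, 12359989293, 6921106569]⟩,
   ⟨[2, 2, 1, 1, 1, 2, 1, 2, 2, 1, 1, 1, 2, 2, 2, 2], 407, 1000, [65686573903, 34135864687, 17790078998, 9271263355, 5333002856]⟩,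
   ⟨[2, 2, 2, 1, 1, 1, 1, 2, 1, 2, 1, 1, 2, 2, 2, 2], 125, 1000, [95966606558, 48304942576, 24416362872, 12361211518, 6921732164]⟩,
   ⟨[1, 1, 2, 2, 1, 2, 1, 1, 1, 2, 2, 1, 2, 2, 2, 2], 408, 1000, [54644813178, 24629681080, 11127412139, 4955583626, 2781990133]⟩,
   ⟨[2, 2, 1, 1, 1, 2, 1, 2, 2, 1, 1, 1, 1, 1, 1, 1, 1], 409, 1000, [21782727313, 11972653621, 6581289311, 3606722752, 2179599681]⟩,
   ⟨[2, 1, 2, 2, 1, 1, 1, 2, 1, 2, 2, 1, 1, 1, 1, 1, 1], 92, 410, [108537952761, 44486983584, 18751464691, 8094234051, 3904928811]⟩,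
   ⟨[2, 1, 1, 1, 1, 2, 1, 2, 1, 1, 2, 2, 2, 1, 1, 1, 1], 31, 411, [115063206507, 53739324470, 25602604670, 12373940762, 6662267824]⟩,
   ⟨[1, 1, 2, 2, 1, 2, 1, 1, 1, 2, 2, 1, 2, 2, 1, 1, 1], 412, 1000, [47386520338, 21549468485, 9819827217, 4408053844, 2498942243]⟩,
   ⟨[2, 2, 2, 1, 1, 1, 1, 2, 1, 2, 1, 1, 2, 2, 2, 1, 1], 125, 413, [158277187277, 69479399217, 31624191447, 14816103733, 7809782055]⟩,
   ⟨[1, 1, 2, 2, 1, 2, 1, 1, 1, 2, 2, 1, 1, 1, 1, 2, 1], 414, 1000, [19855580969, 9330042746, 4386454802, 2026094170, 1189595567]⟩,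
   ⟨[2, 1, 1, 2, 1, 2, 1, 1, 1, 1, 2, 2, 2, 2, 1, 2, 1], 8, 415, [97239927721, 47945640047, 23837451218, 11907129493, 6589029130]⟩,
   ⟨[1, 1, 2, 2, 1, 1, 1, 2, 1, 2, 2, 1, 1, 1, 2, 2, 1], 416, 1000, [65452270982, 29173058229, 13036972379, 5747087581, 3185408166]⟩,
   ⟨[1, 1, 1, 1, 2, 2, 1, 2, 1, 1, 1, 2, 2, 1, 2, 2, 1], 417, 1000, [47187158606, 21589842644, 9896443593, 4466844199, 2549628071]⟩,
   ⟨[2, 2, 2, 1, 1, 2, 1, 2, 1, 1, 1, 1, 2, 2, 2, 2, 1], 418, 1000, [70200162381, 36273645675, 18798275508, 9743267174, 5574134649]⟩,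
   ⟨[2, 1, 1, 1, 2, 1, 2, 2, 1, 1, 1, 1, 1, 1, 1, 1, 2], 1000, 419, [7763865265, 2469545023, 785526546, 249621347, 83799792]⟩,
   ⟨[1, 2, 2, 1, 1, 1, 2, 1, 2, 2, 1, 1, 1, 1, 1, 1, 2], 1000, 420, [20182464146, 6041333813, 1808659088, 537940026, 184495853]⟩,
   ⟨[1, 1, 1, 2, 2, 1, 2, 1, 1, 1, 2, 2, 1, 1, 1, 1, 2], 1000, 421, [37171799147, 11275056575, 3423276840, 1033176669, 360838853]⟩,
   ⟨[2, 2, 1, 1, 1, 1, 2, 1, 2, 1, 1, 2, 2, 2, 1, 1, 2], 1000, 422, [51481530260, 17092491052, 5682105704, 1889283865, 666057891]⟩,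
   ⟨[1, 1, 1, 2, 2, 1, 2, 1, 1, 1, 2, 2, 1, 2, 2, 1, 2], 423, 99, [73344657884, 24712476195, 8481869073, 2939688218, 1238372679]⟩,
   ⟨[2, 2, 1, 1, 2, 1, 2, 1, 1, 1, 1, 2, 2, 2, 2, 1, 2], 1000, 424, [18861298538, 6059486685, 1947011970, 625074040, 212128729]⟩,
   ⟨[2, 1, 1, 1, 2, 1, 2, 2, 1, 1, 1, 1, 1, 1, 1, 2, 2], 1000, 425, [10216327987, 3252837760, 1035704523, 329447458, 110712102]⟩,
   ⟨[1, 1, 1, 1, 1, 2, 2, 1, 2, 1, 1, 1, 2, 2, 1, 2, 2], 426, 54, [111836802079, 40537092345, 15059946891, 5658166327, 2631743980]⟩,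
   ⟨[1, 2, 2, 1, 1, 1, 2, 1, 2, 2, 1, 1, 1, 2, 2, 2, 2], 427, 90, [92298594346, 33628361063, 12528470606, 4710679068, 2187580656]⟩,
   ⟨[1, 1, 1, 2, 2, 1, 2, 1, 1, 1, 2, 2, 1, 2, 2, 2, 2], 428, 99, [89534767598, 31557590261, 11376912414, 4147623063, 1859949137]⟩,
   ⟨[1, 2, 2, 1, 1, 1, 2, 1, 2, 2, 1, 1, 1, 1, 1, 1, 1, 1], 1000, 429, [30677959112, 9365223072, 2861473600, 868939812, 305624777]⟩,
   ⟨[2, 2, 1, 2, 2, 1, 1, 1, 2, 1, 2, 2, 1, 1, 1, 1, 1, 1], 430, 46, [132269808827, 53960787481, 22723932713, 9832000422, 4765147851]⟩,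
   ⟨[2, 2, 1, 1, 1, 1, 2, 1, 2, 1, 1, 2, 2, 2, 1, 1, 1, 1], 1000, 431, [62503679597, 21016719856, 7079269474, 2386101480, 853810645]⟩,
   ⟨[1, 1, 1, 2, 2, 1, 2, 1, 1, 1, 2, 2, 1, 2, 2, 1, 1, 1], 432, 99, [77789038067, 26585415083, 9271408291, 3268078100, 1406663104]⟩,
   ⟨[2, 2, 2, 2, 1, 1, 1, 1, 2, 1, 2, 1, 1, 2, 2, 2, 1, 1], 433, 28, [150293482166, 63752042162, 28042026676, 12711428237, 6482401381]⟩,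
   ⟨[1, 1, 1, 2, 2, 1, 2, 1, 1, 1, 2, 2, 1, 1, 1, 1, 2, 1], 1000, 434, [32826880661, 9897308813, 2986339445, 895636384, 310433378]⟩,
   ⟨[2, 2, 1, 1, 2, 1, 2, 1, 1, 1, 1, 2, 2, 2, 2, 1, 2, 1], 1000, 435, [13180270811, 4200856749, 1338929655, 426337785, 143425721]⟩,
   ⟨[1, 1, 1, 2, 2, 1, 1, 1, 2, 1, 2, 2, 1, 1, 1, 2, 2, 1], 436, 128, [106991233033, 39133003356, 14653137501, 5541050369, 2593089226]⟩,
   ⟨[1, 1, 1, 1, 1, 2, 2, 1, 2, 1, 1, 1, 2, 2, 1, 2, 2, 1], 437, 54, [77562819674, 25934192490, 8835630921, 3041456443, 1271921510]⟩,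
   ⟨[1, 2, 2, 2, 1, 1, 2, 1, 2, 1, 1, 1, 1, 2, 2, 2, 2, 1], 438, 51, [98618452787, 36506776107, 13816063402, 5271567846, 2489174793]⟩,
   ⟨[2, 2, 1, 1, 1, 2, 1, 2, 2, 1, 1, 1, 1, 1, 1, 1, 1, 2], 439, 1000, [18696444705, 10294699840, 5668983203, 3112197108, 1884279821]⟩,
   ⟨[2, 1, 2, 2, 1, 1, 1, 2, 1, 2, 2, 1, 1, 1, 1, 1, 1, 2], 92, 1000, [53711160597, 25702509251, 12306879603, 5882838883, 3098955633]⟩,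
   ⟨[2, 1, 1, 1, 2, 2, 1, 2, 1, 1, 1, 2, 2, 1, 1, 1, 1, 2], 71, 440, [99098908384, 44572589399, 20436994210, 9504760529, 4916542006]⟩,
   ⟨[2, 2, 2, 1, 1, 1, 1, 2, 1, 2, 1, 1, 2, 2, 2, 1, 1, 2], 125, 441, [124102123490, 58283145916, 27955327912, 13614879786, 7393632807]⟩,
   ⟨[1, 1, 1, 1, 2, 2, 1, 2, 1, 1, 1, 2, 2, 1, 2, 2, 1, 2], 442, 1000, [34101592667, 15956421357, 7470360511, 3436818229, 2007548419]⟩,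
   ⟨[2, 2, 2, 1, 1, 2, 1, 2, 1, 1, 1, 1, 2, 2, 2, 2, 1, 2], 443, 1000, [45431245904, 24175937305, 12889251938, 6863897355, 4032159933]⟩,
   ⟨[2, 2, 1, 1, 1, 2, 1, 2, 2, 1, 1, 1, 1, 1, 1, 1, 2, 2], 444, 1000, [24602878778, 13502103810, 7410785492, 4055249312, 2446739191]⟩,
   ⟨[1, 1, 1, 1, 1, 1, 2, 2, 1, 2, 1, 1, 1, 2, 2, 1, 2, 2], 183, 1000, [89601076797, 39202018686, 17214790286, 7470055574, 4062775334]⟩,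
   ⟨[1, 1, 2, 2, 1, 1, 1, 2, 1, 2, 2, 1, 1, 1, 2, 2, 2, 2], 445, 1000, [75011201612, 33081949941, 14635844036, 6393122749, 3504256235]⟩,
   ⟨[1, 1, 1, 1, 2, 2, 1, 2, 1, 1, 1, 2, 2, 1, 2, 2, 2, 2], 446, 1000, [60282041244, 27146921168, 12255480938, 5454651216, 3060278882]⟩,
   ⟨[2, 1, 2, 2, 1, 1, 1, 2, 1, 2, 2, 1, 1, 1, 1, 1, 1, 1, 1], 92, 447, [81856497166, 35684214595, 15847093551, 7136951973, 3571024665]⟩,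
   ⟨[1, 2, 2, 1, 2, 2, 1, 1, 1, 2, 1, 2, 2, 1, 1, 1, 1, 1, 1], 196, 1000, [90101579830, 39544483836, 17419585562, 7581556963, 4139308694]⟩,
   ⟨[2, 2, 2, 1, 1, 1, 1, 2, 1, 2, 1, 1, 2, 2, 2, 1, 1, 1, 1], 125, 448, [150719454565, 67065094525, 30852939987, 14569970234, 7726785720]⟩,
   ⟨[1, 1, 1, 1, 2, 2, 1, 2, 1, 1, 1, 2, 2, 1, 2, 2, 1, 1, 1], 449, 1000, [41283833698, 19052279936, 8805283039, 4004256438, 2306639975]⟩,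
   ⟨[1, 2, 2, 2, 2, 1, 1, 1, 1, 2, 1, 2, 1, 1, 2, 2, 2, 1, 1], 102, 450, [115505800232, 47636369350, 19997218796, 8396490428, 4439654940]⟩,
   ⟨[2, 1, 1, 1, 2, 2, 1, 2, 1, 1, 1, 2, 2, 1, 1, 1, 1, 2, 1], 71, 451, [87445277351, 40472936123, 18994752787, 8998004240, 4727447809]⟩,
   ⟨[2, 2, 2, 1, 1, 2, 1, 2, 1, 1, 1, 1, 2, 2, 2, 2, 1, 2, 1], 452, 1000, [31741387805, 17359509841, 9495141938, 5178111041, 3112778548]⟩,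
   ⟨[1, 1, 1, 1, 2, 2, 1, 1, 1, 2, 1, 2, 2, 1, 1, 1, 2, 2, 1], 112, 1000, [89606862060, 39204838411, 17216153699, 7470698355, 4063159863]⟩,
   ⟨[1, 1, 1, 1, 1, 1, 2, 2, 1, 2, 1, 1, 1, 2, 2, 1, 2, 2, 1], 453, 1000, [34093338590, 15952604411, 7468594614, 3436015069, 2007086282]⟩,
   ⟨[1, 1, 2, 2, 2, 1, 1, 2, 1, 2, 1, 1, 1, 1, 2, 2, 2, 2, 1], 80, 1000, [87066905513, 37949900604, 16600300418, 7175926148, 3883055678]⟩,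
   ⟨[1, 2, 2, 1, 1, 1, 2, 1, 2, 2, 1, 1, 1, 1, 1, 1, 1, 1, 2], 1000, 454, [26333344355, 7987571632, 2424566756, 731409145, 255222828]⟩,
   ⟨[2, 2, 1, 1, 1, 2, 2, 1, 2, 1, 1, 1, 2, 2, 1, 1, 1, 1, 2], 1000, 34, [67961971182, 22970496997, 7778625780, 2636120232, 948834566]⟩,
   ⟨[2, 2, 2, 2, 1, 1, 1, 1, 2, 1, 2, 1, 1, 2, 2, 2, 1, 1, 2], 1000, 28, [67937365857, 22962413794, 7775971562, 2635250061, 948532960]⟩,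
   ⟨[1, 1, 1, 1, 1, 2, 2, 1, 2, 1, 1, 1, 2, 2, 1, 2, 2, 1, 2], 1000, 54, [56326467909, 17286640586, 5313337248, 1623962804, 575977353]⟩,
   ⟨[1, 2, 2, 2, 1, 1, 2, 1, 2, 1, 1, 1, 1, 2, 2, 2, 2, 1, 2], 455, 51, [63898004750, 21711240123, 7508601165, 2619481077, 1110682456]⟩,
   ⟨[1, 2, 2, 1, 1, 1, 2, 1, 2, 2, 1, 1, 1, 1, 1, 1, 1, 2, 2], 1000, 456, [34647524562, 10634583493, 3267439931, 997793350, 353308678]⟩,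
   ⟨[1, 1, 1, 2, 2, 1, 1, 1, 2, 1, 2, 2, 1, 1, 1, 2, 2, 2, 2], 457, 128, [122349557612, 46251248162, 17953841020, 7045539396, 3461230578]⟩,
   ⟨[1, 1, 1, 1, 1, 2, 2, 1, 2, 1, 1, 1, 2, 2, 1, 2, 2, 2, 2], 458, 54, [98753596660, 34904685372, 12634299811, 4628325133, 2089761343]⟩,
   ⟨[2, 2, 1, 2, 2, 1, 1, 1, 2, 1, 2, 2, 1, 1, 1, 1, 1, 1, 1, 1], 1000, 46, [67961080302, 22970154867, 7778495655, 2636071200, 948815006]⟩,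
   ⟨[2, 2, 2, 2, 1, 1, 1, 1, 2, 1, 2, 1, 1, 2, 2, 2, 1, 1, 1, 1], 459, 28, [132091598567, 53873895511, 22680945548, 9810589233, 4753400848]⟩,
   ⟨[1, 1, 1, 1, 1, 2, 2, 1, 2, 1, 1, 1, 2, 2, 1, 2, 2, 1, 1, 1], 460, 54, [67985331491, 22017705083, 7233649478, 2394163625, 952452011]⟩,
   ⟨[2, 1, 2, 2, 2, 2, 1, 1, 1, 1, 2, 1, 2, 1, 1, 2, 2, 2, 1, 1], 1000, 120, [68778413385, 23230372573, 7861361018, 2662439943, 957682670]⟩,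
   ⟨[2, 2, 1, 1, 1, 2, 2, 1, 2, 1, 1, 1, 2, 2, 1, 1, 1, 1, 2, 1], 1000, 461, [39828498621, 12993021749, 4239920049, 1382544201, 476968793]⟩,
   ⟨[1, 2, 2, 2, 1, 1, 2, 1, 2, 1, 1, 1, 1, 2, 2, 2, 2, 1, 2, 1], 1000, 51, [44693973809, 13886296831, 4319350991, 1335238769, 479663172]⟩,
   ⟨[1, 1, 1, 1, 1, 1, 1, 2, 2, 1, 2, 1, 1, 1, 2, 2, 1, 2, 2, 1], 1000, 217, [56312869875, 17282264062, 5311928456, 1623512797, 575809569]⟩,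
   ⟨[2, 1, 2, 2, 1, 1, 1, 2, 1, 2, 2, 1, 1, 1, 1, 1, 1, 1, 1, 2], 92, 462, [70203680788, 31584847700, 14404952801, 6630231032, 3381943648]⟩,
   ⟨[1, 1, 2, 2, 2, 1, 1, 2, 1, 2, 1, 1, 1, 1, 2, 2, 2, 2, 1, 2], 463, 1000, [30834279808, 14407147008, 6735368245, 3094387898, 1804229147]⟩,
   ⟨[2, 1, 2, 2, 1, 1, 1, 2, 1, 2, 2, 1, 1, 1, 1, 1, 1, 1, 2, 2], 92, 464, [92515983122, 39228451519, 17025549810, 7528361528, 3708649640]⟩,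
   ⟨[1, 1, 1, 1, 2, 2, 1, 1, 1, 2, 1, 2, 2, 1, 1, 1, 2, 2, 2, 2], 112, 465, [114921220730, 47280292223, 19792756108, 8286647586, 4364319723]⟩,
   ⟨[1, 1, 1, 1, 1, 1, 2, 2, 1, 2, 1, 1, 1, 2, 2, 1, 2, 2, 2, 2], 466, 1000, [68368554439, 30556034276, 13693138409, 6052821504, 3366959445]⟩,
   ⟨[1, 2, 2, 2, 2, 1, 1, 1, 1, 2, 1, 2, 1, 1, 2, 2, 2, 1, 1, 1, 1], 102, 1000, [89884616129, 39462196162, 17388849230, 7570397141, 4134714308]⟩,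
   ⟨[1, 1, 1, 1, 1, 1, 2, 2, 1, 2, 1, 1, 1, 2, 2, 1, 2, 2, 1, 1, 1], 467, 1000, [18705192383, 8820567130, 4161509121, 1928623001, 1137274218]⟩,
   ⟨[2, 2, 2, 1, 1, 1, 2, 2, 1, 2, 1, 1, 1, 2, 2, 1, 1, 1, 1, 2, 1], 60, 1000, [95970093157, 48306559424, 24417112670, 12361558514, 6921909774]⟩,
   ⟨[2, 2, 1, 2, 2, 1, 1, 1, 2, 1, 2, 2, 1, 1, 1, 1, 1, 1, 1, 1, 2], 1000, 468, [39829574393, 12993380034, 4240039377, 1382583900, 476982776]⟩,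
   ⟨[1, 1, 1, 2, 2, 2, 1, 1, 2, 1, 2, 1, 1, 1, 1, 2, 2, 2, 2, 1, 2], 1000, 116, [50913676701, 15717981414, 4858749413, 1493049539, 532743248]⟩,
   ⟨[2, 2, 1, 2, 2, 1, 1, 1, 2, 1, 2, 2, 1, 1, 1, 1, 1, 1, 1, 2, 2], 469, 46, [93657890393, 34969160197, 13381608103, 5247085365, 2292865311]⟩,
   ⟨[2, 1, 1, 1, 1, 2, 2, 1, 1, 1, 2, 1, 2, 2, 1, 1, 1, 2, 2, 2, 2], 1000, 104, [67953776023, 22967916880, 7777823246, 2635874570, 948757014]⟩,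
   ⟨[1, 1, 1, 1, 1, 1, 1, 2, 2, 1, 2, 1, 1, 1, 2, 2, 1, 2, 2, 2, 2], 470, 217, [111822609064, 40532497401, 15058459486, 5657688935, 2631565645]⟩,
   ⟨[1, 1, 1, 1, 1, 1, 1, 2, 2, 1, 2, 1, 1, 1, 2, 2, 1, 2, 2, 1, 1, 1], 1000, 471, [30949380511, 9191006561, 2730241770, 805940414, 274044915]⟩,
   ⟨[2, 2, 2, 1, 2, 2, 1, 1, 1, 2, 1, 2, 2, 1, 1, 1, 1, 1, 1, 1, 1, 2], 27, 1000, [95972686625, 48307762098, 24417670399, 12361816623, 6922041887]⟩,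
   ⟨[1, 2, 2, 1, 2, 2, 1, 1, 1, 2, 1, 2, 2, 1, 1, 1, 1, 1, 1, 1, 2, 2], 472, 1000, [35962139071, 16839829166, 7890018657, 3632584115, 2123977085]⟩,
   ⟨[1, 1, 1, 1, 1, 1, 1, 1, 2, 2, 1, 2, 1, 1, 1, 2, 2, 1, 2, 2, 2, 2], 121, 1000, [89600139501, 39201478997, 17214497022, 7469905299, 4062677847]⟩,
   ⟨[2, 1, 1, 1, 1, 1, 1, 1, 2, 2, 1, 2, 1, 1, 1, 2, 2, 1, 2, 2, 1, 1, 1], 86, 1000, [82279872220, 40744869967, 20240579683, 10062042231, 5525462666]⟩,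
   ⟨[1, 1, 2, 2, 1, 2, 2, 1, 1, 1, 2, 1, 2, 2, 1, 1, 1, 1, 1, 1, 1, 2, 2], 1000, 66, [59409675047, 18174796828, 5569120978, 1697157459, 599964661]⟩]

/-- The index of the state following `e` when the digit `a` is read. -/
def CertState.next (e : CertState) : ℕ → ℕ
  | 1 => e.next₁
  | _ => e.next₂

/-- The forbidden words and their reverses. -/
def forbiddenBoth : List (List ℕ) := forbiddenX ++ forbiddenX.map List.reverse

/-- The transition of `e` on the digit `a` is compatible with the labels. -/
def transitionOK (e : CertState) (a : ℕ) : Bool :=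
  match certStates[e.next a]? with
  | none => forbiddenBoth.any fun f => f.isPrefixOf (a :: e.label)
  | some e' => e'.label.isPrefixOf (a :: e.label)

/-- The contribution of the transition on the digit `a` to the transfer operator at `e`. -/
def transferTerm (e : CertState) (b a : ℕ) : List ℤ :=
  match certStates[e.next a]? with
  | none => []
  | some e' => polyComb e'.weight (transferMatrix b a)

/-- The verification of a single state. -/
def stateOK (e : CertState) : Bool :=
  match e.label with
  | [] => false
  | b :: _ => (b == 1 || b == 2) && e.weight.length == 5 && e.weight.all (1 ≤ ·) &&
      transitionOK e 1 && transitionOK e 2 &&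
      polyNonneg (polyAdd (polyScale 999999900000 e.weight)
        (polyScale (-1) (polyAdd (transferTerm e b 1) (transferTerm e b 2))))

lemma certStates_ok : certStates.all stateOK = true := by decide +kernel

/-- The inequalities claimed by `transferMatrix`, where `u` is the polynomial `1000 (a + x)` and
`y` is the polynomial `1000 u (rightEnd a / 1000 - (a + x)⁻¹)`; the bound for the current row is
`num / den`. -/
def rowsOK (width : ℤ) (u y : List ℤ) : List ℤ → List ℤ → List (List ℤ) → Bool
  | _, _, [] => true
  | num, den, r :: rs =>
    polyNonneg (polyHomog width 1000 (polyAdd (polyMul r den) (polyScale (-1) num))) &&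
      rowsOK width u y (polyMul y num) (polyScale 1000 (polyMul den u)) rs

/-- The verification of `transferMatrix b a`. -/
def matrixOK (b a : ℕ) : Bool :=
  let u : List ℤ := [1000 * a + rightEnd b, -1000]
  (transferMatrix b a).length == 5 &&
    rowsOK (rightEnd b - leftEnd b) u (polyAdd (polyScale (rightEnd a) u) [-10 ^ 6])
      [10 ^ 15] u (transferMatrix b a)

lemma transferMatrix_ok :
    (matrixOK 1 1 && matrixOK 1 2 && matrixOK 2 1 && matrixOK 2 2) = true := by decide +kernel

/-! ### Convergents and cylinders -/

/-- The first `m` digits of `b`, the last one first. -/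
def revPrefix (b : ℕ → ℕ) : ℕ → List ℕ
  | 0 => []
  | m + 1 => b m :: revPrefix b m

/-- The continuant recursion `(u, v) ↦ (a u + v, u)` along a list of digits, the last digit
first, started at `p`. -/
def continuantFrom (p : ℕ × ℕ) : List ℕ → ℕ × ℕ
  | [] => p
  | a :: w => (a * (continuantFrom p w).1 + (continuantFrom p w).2, (continuantFrom p w).1)

lemma cfNum_eq_continuantFrom (b : ℕ → ℕ) (n : ℕ) :
    cfNum b n = (continuantFrom (1, 0) (revPrefix b (n + 1))).1 := by
  induction n using Nat.twoStepInduction with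
  | zero => simp [cfNum, revPrefix, continuantFrom]
  | one => simp [cfNum, revPrefix, continuantFrom]
  | more n h1 h2 => rw [cfNum, h1, h2]; rfl

lemma cfDen_eq_continuantFrom (b : ℕ → ℕ) (n : ℕ) :
    cfDen b n = (continuantFrom (0, 1) (revPrefix b (n + 1))).1 := by
  induction n using Nat.twoStepInduction with
  | zero => simp [cfDen, revPrefix, continuantFrom]
  | one => simp [cfDen, revPrefix, continuantFrom]
  | more n h1 h2 => rw [cfDen, h1, h2]; rfl

section Convergents

variable {b : ℕ → ℕ}

lemma cfNum_bounds (hb : ∀ n, b n = 1 ∨ b n = 2) (n : ℕ) :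
    0 < cfNum b n ∧ cfNum b n ≤ cfNum b (n + 1) ∧ cfNum b (n + 1) ≤ 3 * cfNum b n ∧
      4 * cfNum b n ≤ 3 * cfNum b (n + 1) := by
  induction n with
  | zero =>
    rcases hb 0 with h0 | h0 <;> rcases hb 1 with h1 | h1 <;> simp [cfNum, h0, h1]
  | succ n ih =>
    have : cfNum b (n + 2) = b (n + 2) * cfNum b (n + 1) + cfNum b n := rfl
    rcases hb (n + 2) with h | h <;> rw [h] at this <;> rw [this] <;> omega

lemma cfDen_le_cfNum (hb : ∀ n, b n = 1 ∨ b n = 2) (n : ℕ) :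
    0 < cfDen b n ∧ cfDen b n ≤ cfNum b n ∧ cfNum b n ≤ 3 * cfDen b n := by
  induction n using Nat.twoStepInduction with
  | zero => rcases hb 0 with h0 | h0 <;> simp [cfNum, cfDen, h0]
  | one =>
    rcases hb 0 with h0 | h0 <;> rcases hb 1 with h1 | h1 <;> simp [cfNum, cfDen, h0, h1]
  | more n h1 h2 =>
    rcases hb (n + 2) with h | h <;> rw [cfNum, cfDen, h] <;> omega

lemma cfNum_mul_cfDen_sub (b : ℕ → ℕ) (n : ℕ) :
    (cfNum b (n + 1) * cfDen b n - cfNum b n * cfDen b (n + 1) : ℝ) = (-1) ^ n := by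
  induction n with
  | zero => simp [cfNum, cfDen]; ring
  | succ n ih =>
    rw [cfNum, cfDen, pow_succ, ← ih]; push_cast; ring

lemma le_cfNum (hb : ∀ n, b n = 1 ∨ b n = 2) (n : ℕ) : n ≤ cfNum b n := by
  induction n using Nat.twoStepInduction with
  | zero => simp
  | one => simp [cfNum]
  | more n h1 h2 =>
    have := (cfNum_bounds hb n).1
    have : cfNum b (n + 2) = b (n + 2) * cfNum b (n + 1) + cfNum b n := rfl
    rcases hb (n + 2) with h | h <;> rw [h] at this <;> omega

/-- Geometric decay of the distance between consecutive convergents. -/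
lemma dist_convergents_le (hb : ∀ n, b n = 1 ∨ b n = 2) (m k : ℕ) :
    dist ((cfDen b (m + k) : ℝ) / cfNum b (m + k))
      ((cfDen b (m + (k + 1)) : ℝ) / cfNum b (m + (k + 1))) ≤
      1 / (cfNum b m : ℝ) ^ 2 * (9 / 16 : ℝ) ^ k := by
  have hpos : ∀ n, (0 : ℝ) < cfNum b n := fun n => by exact_mod_cast (cfNum_bounds hb n).1
  have hgrow : ∀ k, (4 / 3 : ℝ) ^ k * cfNum b m ≤ cfNum b (m + k) := by
    intro k
    induction k with
    | zero => simp
    | succ k ih =>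
      have h4 : (4 : ℝ) * cfNum b (m + k) ≤ 3 * cfNum b (m + (k + 1)) := by
        exact_mod_cast (cfNum_bounds hb (m + k)).2.2.2
      rw [pow_succ]; linarith
  have hmono : (cfNum b (m + k) : ℝ) ≤ cfNum b (m + (k + 1)) := by
    exact_mod_cast (cfNum_bounds hb (m + k)).2.1
  have hdet := cfNum_mul_cfDen_sub b (m + k)
  have hm := hpos m
  have h0 := hpos (m + k)
  have h1 := hpos (m + (k + 1))
  rw [Real.dist_eq]
  have : ((cfDen b (m + k) : ℝ) / cfNum b (m + k) -
      (cfDen b (m + (k + 1)) : ℝ) / cfNum b (m + (k + 1))) =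
      (-1) ^ (m + k) / (cfNum b (m + k) * cfNum b (m + (k + 1))) := by
    rw [← hdet, ← add_assoc]
    rw [← add_assoc] at h1
    field_simp
  rw [this, abs_div, abs_pow, abs_neg, abs_one, one_pow, abs_of_pos (mul_pos h0 h1)]
  calc 1 / ((cfNum b (m + k) : ℝ) * cfNum b (m + (k + 1)))
      ≤ 1 / (((4 / 3 : ℝ) ^ k * cfNum b m) * ((4 / 3 : ℝ) ^ k * cfNum b m)) := by
        have := hgrow k
        gcongr
        exact this.trans hmono
    _ = 1 / (cfNum b m : ℝ) ^ 2 * (9 / 16 : ℝ) ^ k := by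
        have : (9 / 16 : ℝ) ^ k = 1 / ((4 / 3 : ℝ) ^ k * (4 / 3 : ℝ) ^ k) := by
          rw [← mul_pow, one_div, ← inv_pow]; norm_num
        rw [this]; field_simp

/-- Distance from a convergent to the value of a continued fraction with digits `1` and `2`. -/
lemma dist_convergent_cf01_le (hb : ∀ n, b n = 1 ∨ b n = 2) (m : ℕ) :
    dist ((cfDen b m : ℝ) / cfNum b m) (cf01 b) ≤ 16 / 7 / (cfNum b m : ℝ) ^ 2 := by
  have hcauchy : CauchySeq fun n => (cfDen b n : ℝ) / cfNum b n := by
    refine cauchySeq_of_le_geometric (9 / 16) (1 / (cfNum b 0 : ℝ) ^ 2) (by norm_num) fun n => ?_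
    simpa only [zero_add] using dist_convergents_le hb 0 n
  obtain ⟨y, hy⟩ := cauchySeq_tendsto_of_complete hcauchy
  have hy0 : 1 / 3 ≤ y := by
    refine ge_of_tendsto' hy fun n => ?_
    obtain ⟨h1, h2, h3⟩ := cfDen_le_cfNum hb n
    have h4 : (0 : ℝ) < cfNum b n := by exact_mod_cast (cfNum_bounds hb n).1
    have h5 : (cfNum b n : ℝ) ≤ 3 * cfDen b n := by exact_mod_cast h3
    rw [le_div_iff₀ h4]; linarith
  have hcf : cf01 b = y := by
    have h := hy.inv₀ (by linarith : y ≠ 0)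
    simp only [inv_div] at h
    rw [cf01, cfVal, h.limUnder_eq, one_div, inv_inv]
  have htail : Filter.Tendsto (fun k => (cfDen b (m + k) : ℝ) / cfNum b (m + k)) Filter.atTop
      (nhds y) := by
    have := (Filter.tendsto_add_atTop_iff_nat m).2 hy
    simpa only [add_comm] using this
  have := dist_le_of_le_geometric_of_tendsto₀ (9 / 16) (1 / (cfNum b m : ℝ) ^ 2) (by norm_num)
    (dist_convergents_le hb m) htail
  rw [hcf]
  refine this.trans_eq ?_
  rw [show (1 : ℝ) - 9 / 16 = 7 / 16 by norm_num]
  ring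

end Convergents

/-- The digit sequences over `{1, 2}` avoiding the forbidden words and their reverses. -/
def Admissible (b : ℕ → ℕ) : Prop :=
  (∀ n, b n ∈ ({1, 2} : Set ℕ)) ∧
    ∀ w ∈ forbiddenX, ∀ i, ¬ occursAtN b i w ∧ ¬ occursAtN b i w.reverse

/-- The values of admissible sequences whose first digits are `w`, the last one first. -/
def cylinder (w : List ℕ) : Set ℝ :=
  {x | ∃ b, Admissible b ∧ revPrefix b w.length = w ∧ x = cf01 b}

lemma Admissible.digit {b : ℕ → ℕ} (hb : Admissible b) (n : ℕ) : b n = 1 ∨ b n = 2 := hb.1 n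

lemma cylinder_subset (w : List ℕ) : cylinder w ⊆ cylinder (1 :: w) ∪ cylinder (2 :: w) := by
  rintro x ⟨b, hb, hw, rfl⟩
  rcases hb.digit w.length with h | h
  · exact Or.inl ⟨b, hb, by simp [revPrefix, hw, h], rfl⟩
  · exact Or.inr ⟨b, hb, by simp [revPrefix, hw, h], rfl⟩

lemma reverse_revPrefix (b : ℕ → ℕ) (m : ℕ) : (revPrefix b m).reverse = (List.range m).map b := by
  induction m with
  | zero => rfl
  | succ m ih => simp [revPrefix, ih, List.range_succ]

lemma occursAtN_of_prefix_revPrefix {b : ℕ → ℕ} {f : List ℕ} {m : ℕ} (h : f <+: revPrefix b m) :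
    ∃ i, occursAtN b i f.reverse := by
  obtain ⟨t, ht⟩ := h
  have hmap : (List.range m).map b = t.reverse ++ f.reverse := by
    rw [← reverse_revPrefix, ← ht, List.reverse_append]
  refine ⟨t.length, fun j hj => ?_⟩
  have hget := congrArg (fun l : List ℕ => l[t.length + j]?) hmap
  have hlen := congrArg List.length hmap
  simp only [List.length_map, List.length_range, List.length_append, List.length_reverse] at hlen hj
  rw [List.getD_eq_getElem?_getD]
  have e1 : ((List.range m).map b)[t.length + j]? = some (b (t.length + j)) := by
    rw [List.getElem?_map, List.getElem?_range (by omega)]; rfl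
  have e2 : (t.reverse ++ f.reverse)[t.length + j]? = f.reverse[j]? := by
    rw [List.getElem?_append_right (by simp)]; simp
  simp only [e1, e2] at hget
  rw [← hget]; rfl

lemma not_prefix_revPrefix {b : ℕ → ℕ} (hb : Admissible b) {f : List ℕ} (hf : f ∈ forbiddenBoth)
    (m : ℕ) : ¬ f <+: revPrefix b m := by
  intro h
  obtain ⟨i, hi⟩ := occursAtN_of_prefix_revPrefix h
  rw [forbiddenBoth, List.mem_append, List.mem_map] at hf
  rcases hf with hf | ⟨g, hg, rfl⟩
  · exact (hb.2 f hf i).2 hi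
  · exact (hb.2 g hg i).1 (by simpa using hi)

lemma dist_cylinder_le {w : List ℕ} (hw : w ≠ []) {x y : ℝ} (hx : x ∈ cylinder w)
    (hy : y ∈ cylinder w) : dist x y ≤ 5 / ((continuantFrom (1, 0) w).1 : ℝ) ^ 2 := by
  obtain ⟨b, hb, hbw, rfl⟩ := hx
  obtain ⟨c, hc, hcw, rfl⟩ := hy
  obtain ⟨m, hm⟩ : ∃ m, w.length = m + 1 := Nat.exists_eq_succ_of_ne_zero (by simpa using hw)
  rw [hm] at hbw hcw
  have h1 := dist_convergent_cf01_le hb.digit m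
  have h2 := dist_convergent_cf01_le hc.digit m
  rw [cfNum_eq_continuantFrom, cfDen_eq_continuantFrom, hbw] at h1
  rw [cfNum_eq_continuantFrom, cfDen_eq_continuantFrom, hcw] at h2
  refine (dist_triangle_left _ _ _).trans ((add_le_add h1 h2).trans ?_)
  rw [← add_div]
  gcongr
  norm_num

lemma le_continuant_of_cylinder_nonempty {w : List ℕ} (hw : w ≠ []) (hx : (cylinder w).Nonempty) :
    0 < (continuantFrom (1, 0) w).1 ∧ w.length ≤ (continuantFrom (1, 0) w).1 + 1 := by
  obtain ⟨-, b, hb, hbw, -⟩ := hx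
  obtain ⟨m, hm⟩ : ∃ m, w.length = m + 1 := Nat.exists_eq_succ_of_ne_zero (by simpa using hw)
  rw [hm] at hbw ⊢
  rw [← hbw, ← cfNum_eq_continuantFrom]
  exact ⟨(cfNum_bounds hb.digit m).1, by have := le_cfNum hb.digit m; omega⟩

/-! ### The transfer operator inequality -/

lemma rowsOK_sound {width : ℤ} {u y : List ℤ} {z : ℝ} (hz : 0 ≤ z) (hzw : 1000 * z < width)
    (hu : 0 < polyEval u z) {rows : List (List ℤ)} :
    ∀ {num den cs : List ℤ}, rowsOK width u y num den rows = true → 0 < polyEval den z →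
      cs.length = rows.length → (∀ c ∈ cs, 1 ≤ c) →
      polyEval num z / polyEval den z * polyEval cs (polyEval y z / (1000 * polyEval u z)) ≤
        polyEval (polyComb cs rows) z := by
  induction rows with
  | nil =>
    intro num den cs _ _ hlen _
    rw [List.length_nil, List.length_eq_zero_iff] at hlen
    simp [hlen, polyComb]
  | cons r rs ih =>
    intro num den cs h hden hlen hcs
    obtain _ | ⟨c, cs⟩ := cs
    · simp at hlen
    simp only [rowsOK, Bool.and_eq_true] at h
    have hrow := polyEval_nonneg_of_homog h.1 (by norm_num) hz (by push_cast; exact hzw)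
    have hrest := ih (cs := cs) h.2 (by simp; positivity) (by simpa using hlen)
      fun c' hc' => hcs c' (List.mem_cons_of_mem _ hc')
    have hc : (0 : ℝ) ≤ c := by
      have : 1 ≤ c := hcs c List.mem_cons_self
      exact_mod_cast (by omega : 0 ≤ c)
    simp only [polyEval_add, polyEval_mul, polyEval_scale, polyComb, polyEval_cons] at hrow hrest ⊢
    have hr : polyEval num z / polyEval den z ≤ polyEval r z := by
      rw [div_le_iff₀ hden]; push_cast at hrow; linarith
    have hsplit : polyEval num z / polyEval den z * (c + polyEval y z / (1000 * polyEval u z) *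
        polyEval cs (polyEval y z / (1000 * polyEval u z))) =
        c * (polyEval num z / polyEval den z) + polyEval y z * polyEval num z /
          (1000 * (polyEval den z * polyEval u z)) *
            polyEval cs (polyEval y z / (1000 * polyEval u z)) := by
      field_simp
    rw [hsplit]
    push_cast at hrest
    exact add_le_add (mul_le_mul_of_nonneg_left hr hc) hrest

/-- The value at `x` of the polynomial with coefficients `p` in `rightEnd b / 1000 - x`. -/
noncomputable def weightAt (p : List ℤ) (b : ℕ) (x : ℝ) : ℝ :=
  polyEval p ((rightEnd b : ℝ) / 1000 - x)

/-- The interval containing the reversed prefixes whose last digit is `b`. -/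
def digitInterval (b : ℕ) : Set ℝ := Set.Ioc ((leftEnd b : ℝ) / 1000) ((rightEnd b : ℝ) / 1000)

lemma digitInterval_subset {b : ℕ} (hb : b = 1 ∨ b = 2) :
    digitInterval b ⊆ Set.Ioc (36 / 100) (74 / 100) := by
  rcases hb with rfl | rfl <;>
    exact Set.Ioc_subset_Ioc (by norm_num [leftEnd]) (by norm_num [rightEnd])

lemma inv_mem_digitInterval {a : ℕ} (ha : a = 1 ∨ a = 2) {x : ℝ}
    (hx : x ∈ Set.Ioc (36 / 100 : ℝ) (74 / 100)) : (a + x)⁻¹ ∈ digitInterval a := by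
  obtain ⟨h1, h2⟩ := hx
  rcases ha with rfl | rfl <;> constructor <;> rw [inv_eq_one_div]
  · rw [lt_div_iff₀ (by push_cast; linarith)]; norm_num [leftEnd]; linarith
  · rw [div_le_iff₀ (by push_cast; linarith)]; norm_num [rightEnd]; linarith
  · rw [lt_div_iff₀ (by push_cast; linarith)]; norm_num [leftEnd]; linarith
  · rw [div_le_iff₀ (by push_cast; linarith)]; norm_num [rightEnd]; linarith

lemma one_le_weightAt {p : List ℤ} (hne : p ≠ []) (hp : ∀ c ∈ p, 1 ≤ c) {b : ℕ} {x : ℝ}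
    (hx : x ∈ digitInterval b) : 1 ≤ weightAt p b x := by
  obtain ⟨c, p, rfl⟩ := List.exists_cons_of_ne_nil hne
  have hz : 0 ≤ (rightEnd b : ℝ) / 1000 - x := sub_nonneg.2 hx.2
  have h1 : (1 : ℝ) ≤ c := by exact_mod_cast hp c List.mem_cons_self
  have h2 : polyNonneg p = true := by
    rw [polyNonneg, List.all_eq_true]
    intro e he
    have := hp e (List.mem_cons_of_mem _ he)
    exact decide_eq_true (by omega)
  rw [weightAt, polyEval_cons]
  nlinarith [mul_nonneg hz (polyEval_nonneg h2 hz)]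

lemma matrixOK_of_digits {a b : ℕ} (ha : a = 1 ∨ a = 2) (hb : b = 1 ∨ b = 2) :
    matrixOK b a = true := by
  have := transferMatrix_ok
  simp only [Bool.and_eq_true] at this
  rcases ha with rfl | rfl <;> rcases hb with rfl | rfl <;> simp [this]

lemma transferMatrix_bound {a b : ℕ} (ha : a = 1 ∨ a = 2) (hb : b = 1 ∨ b = 2) {cs : List ℤ}
    (hlen : cs.length = 5) (hcs : ∀ c ∈ cs, 1 ≤ c) {x : ℝ} (hx : x ∈ digitInterval b) :
    10 ^ 12 * ((a + x)⁻¹ * weightAt cs a (a + x)⁻¹) ≤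
      weightAt (polyComb cs (transferMatrix b a)) b x := by
  have hok := matrixOK_of_digits ha hb
  simp only [matrixOK, Bool.and_eq_true, beq_iff_eq] at hok
  have hx0 : 0 < a + x := by
    have := (digitInterval_subset hb hx).1
    positivity
  have hU : polyEval [1000 * (a : ℤ) + rightEnd b, -1000] ((rightEnd b : ℝ) / 1000 - x) =
      1000 * (a + x) := by
    simp; ring
  have hY : polyEval (polyAdd (polyScale (rightEnd a) [1000 * (a : ℤ) + rightEnd b, -1000])
      [-10 ^ 6]) ((rightEnd b : ℝ) / 1000 - x) = rightEnd a * (1000 * (a + x)) - 10 ^ 6 := by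
    rw [polyEval_add, polyEval_scale, hU]; simp; ring
  have := rowsOK_sound (z := (rightEnd b : ℝ) / 1000 - x) (sub_nonneg.2 hx.2)
    (by push_cast; linarith [hx.1]) (by rw [hU]; positivity) hok.2
    (by rw [hU]; positivity) (hlen.trans hok.1.symm) hcs
  rw [hU, hY] at this
  refine le_trans (le_of_eq ?_) this
  have harg : (rightEnd a * (1000 * (a + x)) - 10 ^ 6) / (1000 * (1000 * (a + x))) =
      (rightEnd a : ℝ) / 1000 - (a + x)⁻¹ := by
    field_simp; ring
  rw [harg, weightAt]
  simp only [polyEval_cons, polyEval_nil]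
  push_cast
  field_simp
  ring

/-- The weight of the state following `e` on the digit `a`, or zero if there is none. -/
noncomputable def nextWeight (e : CertState) (a : ℕ) (x : ℝ) : ℝ :=
  match certStates[e.next a]? with
  | none => 0
  | some e' => weightAt e'.weight a x

/-- The information extracted from the verification of a state whose last digit is `b`. -/
structure CertState.IsValid (e : CertState) (b : ℕ) : Prop where
  digit : b = 1 ∨ b = 2
  length_weight : e.weight.length = 5
  one_le_weight : ∀ c ∈ e.weight, 1 ≤ c
  transition : ∀ a, a = 1 ∨ a = 2 → transitionOK e a = true
  subsolution : polyNonneg (polyAdd (polyScale 999999900000 e.weight)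
    (polyScale (-1) (polyAdd (transferTerm e b 1) (transferTerm e b 2)))) = true

lemma exists_isValid {e : CertState} (he : e ∈ certStates) :
    ∃ b l, e.label = b :: l ∧ e.IsValid b := by
  have h := List.all_eq_true.1 certStates_ok e he
  rw [stateOK] at h
  split at h
  · simp at h
  · rename_i b l hl
    simp only [Bool.and_eq_true, Bool.or_eq_true, beq_iff_eq, List.all_eq_true,
      decide_eq_true_eq] at h
    obtain ⟨⟨⟨⟨⟨h1, h2⟩, h3⟩, h4⟩, h5⟩, h6⟩ := h
    exact ⟨b, l, hl, h1, h2, h3, by rintro a (rfl | rfl) <;> assumption, h6⟩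

lemma nextWeight_bound {e : CertState} {a b : ℕ} (ha : a = 1 ∨ a = 2) (hb : b = 1 ∨ b = 2) {x : ℝ}
    (hx : x ∈ digitInterval b) :
    10 ^ 12 * ((a + x)⁻¹ * nextWeight e a (a + x)⁻¹) ≤ weightAt (transferTerm e b a) b x := by
  cases h : certStates[e.next a]? with
  | none => simp [nextWeight, transferTerm, h, weightAt]
  | some e' =>
    obtain ⟨_, _, _, hv⟩ := exists_isValid (List.mem_of_getElem? h)
    simpa only [nextWeight, transferTerm, h] using
      transferMatrix_bound ha hb hv.length_weight hv.one_le_weight hx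

lemma nextWeight_nonneg (e : CertState) {a : ℕ} {x : ℝ} (hx : x ∈ digitInterval a) :
    0 ≤ nextWeight e a x := by
  rw [nextWeight]
  split
  · exact le_rfl
  · rename_i e' he'
    obtain ⟨_, _, _, hv⟩ := exists_isValid (List.mem_of_getElem? he')
    refine zero_le_one.trans (one_le_weightAt ?_ hv.one_le_weight hx)
    intro h
    simpa [h] using hv.length_weight

lemma transfer_le {e : CertState} {b : ℕ} (hv : e.IsValid b) {x : ℝ} (hx : x ∈ digitInterval b) :
    (1 + x)⁻¹ * nextWeight e 1 (1 + x)⁻¹ + (2 + x)⁻¹ * nextWeight e 2 (2 + x)⁻¹ ≤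
      (1 - 1 / 10 ^ 7) * weightAt e.weight b x := by
  have h1 := nextWeight_bound (e := e) (Or.inl rfl : 1 = 1 ∨ _) hv.digit hx
  have h2 := nextWeight_bound (e := e) (Or.inr rfl : 2 = 1 ∨ 2 = 2) hv.digit hx
  have h3 := polyEval_nonneg hv.subsolution (sub_nonneg.2 hx.2)
  simp only [polyEval_add, polyEval_scale, weightAt] at h1 h2 h3 ⊢
  push_cast at h1 h2 h3
  linarith

/-- The exponent `2 s`, where `s < 1 / 2` is the dimension bound. -/
noncomputable def covExponent : ℝ := 1 - 2 / 10 ^ 8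

lemma rpow_neg_covExponent_le {y : ℝ} (hy : 1 ≤ y) (hy3 : y ≤ 3) :
    y ^ (-covExponent) ≤ (1 + 4 / 10 ^ 8) * y⁻¹ := by
  have hy0 : 0 < y := by linarith
  have h : y ^ (-covExponent) = y ^ (2 / 10 ^ 8 : ℝ) * y⁻¹ := by
    rw [← Real.rpow_neg_one y, ← Real.rpow_add hy0]
    congr 1
    rw [covExponent]; ring
  rw [h]
  gcongr
  have := rpow_one_add_le_one_add_mul_self (s := y - 1) (by linarith)
    (p := 2 / 10 ^ 8) (by norm_num) (by norm_num)
  rw [add_sub_cancel] at this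
  linarith

/-- The weights are a subsolution for the transfer operator with exponent `covExponent`. -/
lemma transfer_rpow_le {e : CertState} {b : ℕ} (hv : e.IsValid b) {x : ℝ}
    (hx : x ∈ digitInterval b) :
    (1 + x) ^ (-covExponent) * nextWeight e 1 (1 + x)⁻¹ +
      (2 + x) ^ (-covExponent) * nextWeight e 2 (2 + x)⁻¹ ≤ weightAt e.weight b x := by
  have hx' := digitInterval_subset hv.digit hx
  have hw : 1 ≤ weightAt e.weight b x := one_le_weightAt
    (fun h => by simpa [h] using hv.length_weight) hv.one_le_weight hx
  have n1 : 0 ≤ nextWeight e 1 (1 + x)⁻¹ :=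
    nextWeight_nonneg e (by simpa using inv_mem_digitInterval (Or.inl rfl : 1 = 1 ∨ _) hx')
  have n2 : 0 ≤ nextWeight e 2 (2 + x)⁻¹ :=
    nextWeight_nonneg e (by simpa using inv_mem_digitInterval (Or.inr rfl : 2 = 1 ∨ 2 = 2) hx')
  have p1 := mul_le_mul_of_nonneg_right (rpow_neg_covExponent_le (y := 1 + x)
    (by linarith [hx'.1]) (by linarith [hx'.2])) n1
  have p2 := mul_le_mul_of_nonneg_right (rpow_neg_covExponent_le (y := 2 + x)
    (by linarith [hx'.1]) (by linarith [hx'.2])) n2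
  have := transfer_le hv hx
  linarith

/-! ### Covers and the dimension bound -/

/-- `L` covers `A` by sets of diameter at most `10 / k` whose sum of diameters to the power
`covExponent / 2` is at most `c`. -/
structure IsCover (A : Set ℝ) (L : List (Set ℝ)) (k : ℕ) (c : ℝ) : Prop where
  subset : A ⊆ ⋃ t ∈ L, t
  ediam_le : ∀ t ∈ L, Metric.ediam t ≤ ENNReal.ofReal (10 / k)
  sum_le : (L.map fun t => Metric.ediam t ^ (covExponent / 2)).sum ≤ ENNReal.ofReal c

lemma IsCover.nil {A : Set ℝ} (hA : A = ∅) (k : ℕ) (c : ℝ) : IsCover A [] k c where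
  subset := by simp [hA]
  ediam_le := by simp
  sum_le := by simp

lemma IsCover.append {A B : Set ℝ} {L M : List (Set ℝ)} {k : ℕ} {c d : ℝ} (hA : IsCover A L k c)
    (hB : IsCover B M k d) (hc : 0 ≤ c) (hd : 0 ≤ d) : IsCover (A ∪ B) (L ++ M) k (c + d) where
  subset := by
    rintro x (hx | hx)
    · obtain ⟨t, ht, hxt⟩ := Set.mem_iUnion₂.1 (hA.subset hx)
      exact Set.mem_iUnion₂.2 ⟨t, List.mem_append_left _ ht, hxt⟩
    · obtain ⟨t, ht, hxt⟩ := Set.mem_iUnion₂.1 (hB.subset hx)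
      exact Set.mem_iUnion₂.2 ⟨t, List.mem_append_right _ ht, hxt⟩
  ediam_le t ht := (List.mem_append.1 ht).elim (hA.ediam_le t) (hB.ediam_le t)
  sum_le := by
    rw [List.map_append, List.sum_append, ENNReal.ofReal_add hc hd]
    exact add_le_add hA.sum_le hB.sum_le

lemma IsCover.mono {A B : Set ℝ} {L : List (Set ℝ)} {k : ℕ} {c d : ℝ} (hA : IsCover A L k c)
    (hBA : B ⊆ A) (hcd : c ≤ d) : IsCover B L k d where
  subset := hBA.trans hA.subset
  ediam_le := hA.ediam_le
  sum_le := hA.sum_le.trans (ENNReal.ofReal_le_ofReal hcd)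

lemma isCover_singleton_cylinder {w : List ℕ} (hw : w ≠ []) {u : ℝ} (hu : 0 < u)
    (hu' : u ≤ (continuantFrom (1, 0) w).1) :
    IsCover (cylinder w) [cylinder w] w.length (5 * u ^ (-covExponent)) := by
  have hp : 0 < covExponent := by norm_num [covExponent]
  have hdiam : Metric.ediam (cylinder w) ≤
      ENNReal.ofReal (5 / ((continuantFrom (1, 0) w).1 : ℝ) ^ 2) := by
    refine Metric.ediam_le fun x hx y hy => ?_
    rw [edist_dist]
    exact ENNReal.ofReal_le_ofReal (dist_cylinder_le hw hx hy)
  refine ⟨by simp, ?_, ?_⟩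
  · simp only [List.mem_singleton, forall_eq]
    rcases (cylinder w).eq_empty_or_nonempty with h | h
    · simp [h]
    obtain ⟨h1, h2⟩ := le_continuant_of_cylinder_nonempty hw h
    refine hdiam.trans (ENNReal.ofReal_le_ofReal ?_)
    have h0 : (0 : ℝ) < w.length := by exact_mod_cast List.length_pos_iff.2 hw
    have h3 : (1 : ℝ) ≤ (continuantFrom (1, 0) w).1 := by exact_mod_cast h1
    have h4 : (w.length : ℝ) ≤ (continuantFrom (1, 0) w).1 + 1 := by exact_mod_cast h2
    rw [div_le_div_iff₀ (by positivity) h0]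
    nlinarith
  · simp only [List.map_cons, List.map_nil, List.sum_cons, List.sum_nil, add_zero]
    calc Metric.ediam (cylinder w) ^ (covExponent / 2)
        ≤ ENNReal.ofReal (5 / u ^ 2) ^ (covExponent / 2) := by
          refine ENNReal.rpow_le_rpow (hdiam.trans (ENNReal.ofReal_le_ofReal ?_)) (by positivity)
          gcongr
      _ = ENNReal.ofReal ((5 / u ^ 2) ^ (covExponent / 2)) :=
          ENNReal.ofReal_rpow_of_nonneg (by positivity) (by positivity)
      _ ≤ ENNReal.ofReal (5 * u ^ (-covExponent)) := by
          refine ENNReal.ofReal_le_ofReal ?_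
          have h5 : (5 : ℝ) ^ (covExponent / 2) ≤ 5 := by
            conv_rhs => rw [← Real.rpow_one 5]
            exact Real.rpow_le_rpow_of_exponent_le (by norm_num) (by norm_num [covExponent])
          have h6 : (u ^ 2) ^ (covExponent / 2) = u ^ covExponent := by
            rw [← Real.rpow_natCast, ← Real.rpow_mul hu.le]
            congr 1; push_cast; ring
          rw [Real.div_rpow (by norm_num) (by positivity), h6, Real.rpow_neg hu.le, ← div_eq_mul_inv]
          gcongr

lemma cylinder_eq_empty {e : CertState} {a : ℕ} (h : certStates[e.next a]? = none)
    (hok : transitionOK e a = true) {w : List ℕ} (hw : e.label <+: w) : cylinder (a :: w) = ∅ := by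
  simp [transitionOK, h] at hok
  obtain ⟨f, hf, hpre⟩ := hok
  refine Set.eq_empty_of_forall_notMem ?_
  rintro x ⟨b, hb, hbw, -⟩
  refine not_prefix_revPrefix hb hf (a :: w).length ?_
  rw [hbw]
  exact hpre.trans ((List.prefix_cons_inj a).2 hw)

/-- Covers at all depths of the cylinder of a word that leads to the state `e`. -/
lemma exists_isCover_cylinder (n : ℕ) : ∀ {e : CertState} {b : ℕ} {l w : List ℕ} {u v : ℝ},
    e.label = b :: l → e.IsValid b → e.label <+: w → 0 < u → v / u ∈ digitInterval b →
    u ≤ (continuantFrom (1, 0) w).1 → v ≤ (continuantFrom (1, 0) w).2 →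
    ∃ L, IsCover (cylinder w) L (w.length + n)
      (5 * (weightAt e.weight b (v / u) * u ^ (-covExponent))) := by
  induction n with
  | zero =>
    intro e b l w u v hl hv hw hu hx huN hvN
    have hwne : w ≠ [] := by
      rintro rfl
      simp [hl] at hw
    refine ⟨_, (isCover_singleton_cylinder hwne hu huN).mono subset_rfl ?_⟩
    have h1 : 1 ≤ weightAt e.weight b (v / u) := one_le_weightAt
      (fun h => by simpa [h] using hv.length_weight) hv.one_le_weight hx
    have h2 : 0 ≤ u ^ (-covExponent) := by positivity
    gcongr
    exact le_mul_of_one_le_left h2 h1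
  | succ n ih =>
    intro e b l w u v hl hv hw hu hx huN hvN
    have hx' := digitInterval_subset hv.digit hx
    have hchild : ∀ a : ℕ, a = 1 ∨ a = 2 → ∃ L, IsCover (cylinder (a :: w)) L
        (w.length + (n + 1)) (5 * (((a + v / u) ^ (-covExponent) *
          nextWeight e a (a + v / u)⁻¹) * u ^ (-covExponent))) := by
      intro a ha
      have hok := hv.transition a ha
      cases h : certStates[e.next a]? with
      | none => exact ⟨_, .nil (cylinder_eq_empty h hok hw) _ _⟩
      | some e' =>
        simp [transitionOK, h] at hok
        obtain ⟨b', l', hl', hv'⟩ := exists_isValid (List.mem_of_getElem? h)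
        obtain rfl : b' = a := by
          rw [hl', List.cons_prefix_cons] at hok
          exact hok.1
        have hax : 0 < b' + v / u := by have := hx'.1; positivity
        have hu' : b' * u + v = u * (b' + v / u) := by field_simp
        have hinv : u / (b' * u + v) = (b' + v / u)⁻¹ := by
          rw [hu']; field_simp
        obtain ⟨L, hL⟩ := ih (w := b' :: w) (u := b' * u + v) (v := u) hl' hv'
          (hok.trans ((List.prefix_cons_inj b').2 hw)) (by rw [hu']; positivity)
          (by rw [hinv]; exact inv_mem_digitInterval ha hx')
          (by simp only [continuantFrom]; push_cast; gcongr) huN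
        refine ⟨L, ?_⟩
        convert hL using 1
        · simp; ring
        · rw [hinv, hu', Real.mul_rpow hu.le hax.le, nextWeight, h]; ring
    obtain ⟨L₁, h₁⟩ := hchild 1 (Or.inl rfl)
    obtain ⟨L₂, h₂⟩ := hchild 2 (Or.inr rfl)
    have hnn : ∀ a : ℕ, a = 1 ∨ a = 2 → 0 ≤ 5 * (((a + v / u) ^ (-covExponent) *
        nextWeight e a (a + v / u)⁻¹) * u ^ (-covExponent)) := by
      intro a ha
      have h0 := nextWeight_nonneg e (inv_mem_digitInterval ha hx')
      have := hx'.1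
      positivity
    refine ⟨_, (h₁.append h₂ (hnn 1 (Or.inl rfl)) (hnn 2 (Or.inr rfl))).mono
      (cylinder_subset w) ?_⟩
    have h0 : 0 ≤ u ^ (-covExponent) := by positivity
    have := mul_le_mul_of_nonneg_right (transfer_rpow_le hv hx) h0
    push_cast
    linarith

lemma exists_isCover_digit {d : ℕ} (hd : d = 1 ∨ d = 2) :
    ∃ c, 0 ≤ c ∧ ∀ n, ∃ L, IsCover (cylinder [d]) L (1 + n) c := by
  obtain ⟨e, he, hl⟩ : ∃ e ∈ certStates, e.label = [d] := by
    have h : ([1, 2].all fun d => certStates.any (·.label == [d])) = true := by decide +kernel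
    simp only [List.all_eq_true, List.any_eq_true, beq_iff_eq] at h
    exact h d (by simpa using hd)
  obtain ⟨b, l, hl', hv⟩ := exists_isValid he
  obtain rfl : b = d := (List.cons.inj (hl'.symm.trans hl)).1
  have hb : (0 : ℝ) < b := by rcases hd with rfl | rfl <;> norm_num
  obtain ⟨v, hv1, hx⟩ : ∃ v : ℝ, v ≤ 1 ∧ v / b ∈ digitInterval b := by
    rcases hd with rfl | rfl
    · exact ⟨6 / 10, by norm_num, by norm_num [digitInterval, leftEnd, rightEnd]⟩
    · exact ⟨8 / 10, by norm_num, by norm_num [digitInterval, leftEnd, rightEnd]⟩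
  refine ⟨_, ?_, fun n => exists_isCover_cylinder n (w := [b]) (u := b) (v := v) hl' hv
    (by rw [hl]) hb hx (by simp [continuantFrom]) (by simpa [continuantFrom])⟩
  have := one_le_weightAt (fun h => by simpa [h] using hv.length_weight) hv.one_le_weight hx
  positivity

lemma gaussCantorRev_subset_cylinder :
    gaussCantorRev {1, 2} forbiddenX ⊆ cylinder [1] ∪ cylinder [2] := by
  rintro x ⟨b, hb, hf, rfl⟩
  exact cylinder_subset [] ⟨b, ⟨hb, hf⟩, rfl, rfl⟩

lemma dimH_gaussCantorRev_le :
    dimH (gaussCantorRev {1, 2} forbiddenX) ≤ (covExponent / 2).toNNReal := by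
  obtain ⟨c₁, hc₁, h₁⟩ := exists_isCover_digit (Or.inl rfl : 1 = 1 ∨ _)
  obtain ⟨c₂, hc₂, h₂⟩ := exists_isCover_digit (Or.inr rfl : 2 = 1 ∨ 2 = 2)
  have hcover : ∀ n, ∃ L, IsCover (gaussCantorRev {1, 2} forbiddenX) L (1 + n) (c₁ + c₂) := by
    intro n
    obtain ⟨L, hL⟩ := h₁ n
    obtain ⟨M, hM⟩ := h₂ n
    exact ⟨_, (hL.append hM hc₁ hc₂).mono gaussCantorRev_subset_cylinder le_rfl⟩
  choose L hL using hcover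
  have hr : Tendsto (fun n : ℕ => ENNReal.ofReal (10 / ((1 + n : ℕ) : ℝ))) atTop (nhds 0) := by
    rw [← ENNReal.ofReal_zero]
    refine ENNReal.tendsto_ofReal ?_
    have := (tendsto_const_div_atTop_nhds_zero_nat (10 : ℝ)).comp (tendsto_add_atTop_nat 1)
    simpa only [Function.comp_def, add_comm 1] using this
  refine dimH_le_of_hausdorffMeasure_ne_top (ne_top_of_le_ne_top
    (ENNReal.ofReal_ne_top (r := c₁ + c₂)) ?_)
  rw [Real.coe_toNNReal _ (by norm_num [covExponent])]
  refine (MeasureTheory.Measure.hausdorffMeasure_le_liminf_sum _ _ _ hr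
    (fun n (i : Fin (L n).length) => (L n)[i]) (.of_forall fun n i =>
      (hL n).ediam_le _ (List.getElem_mem _)) (.of_forall fun n x hx => ?_)).trans
    (liminf_le_of_le (by isBoundedDefault) fun y hy => ?_)
  · obtain ⟨t, ht, hxt⟩ := Set.mem_iUnion₂.1 ((hL n).subset hx)
    obtain ⟨i, hi, rfl⟩ := List.getElem_of_mem ht
    exact Set.mem_iUnion.2 ⟨⟨i, hi⟩, hxt⟩
  · obtain ⟨n, hn⟩ := hy.exists
    refine hn.trans (le_trans (le_of_eq ?_) (hL n).sum_le)
    exact Fin.sum_univ_fun_getElem (L n) fun t => Metric.ediam t ^ (covExponent / 2)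

end GaussCantorBound

/-- `dim_H X < 0.5`, where `X` is the set of reals whose continued fraction partial
quotients lie in `{1,2}` and avoid the twenty-four listed strings and their reverses. -/
theorem dimH_X_lt :
    dimH (gaussCantorRev {1, 2} forbiddenX) < ENNReal.ofReal 0.5 := by
  refine GaussCantorBound.dimH_gaussCantorRev_le.trans_lt ?_
  rw [← ENNReal.ofReal.eq_1]
  exact (ENNReal.ofReal_lt_ofReal_iff (by norm_num)).2 (by norm_num [GaussCantorBound.covExponent])
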